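/- arXiv:0909.5541 — 3 statements merged into one kernel-verified Lean document; each statement's English description precedes it below -/
import Mathlib

section
/- Let Z_n(β) = H(n)·exp(−β·(3^{n+1}+1)/2) for real β > 0 (this is the partition function of Hamiltonian paths on SG(n), since every Hamiltonian path of SG(n) has exactly (3^{n+1}+1)/2 edges). Then with β^c = ln(12)/9: if β > β^c then Z_n(β) → 0 as n → ∞, and if 0 < β ≤ β^c then Z_n(β) → ∞ as n → ∞. -/
open scoped Classical
open Filter Topology

noncomputable section

namespace SierpinskiGasket

/-- √3 -/
def sq3 : ℝ := Real.sqrt 3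

/-- the origin, leftmost outmost vertex of every `SG n` -/
def o : ℝ × ℝ := (0, 0)

/-- `a m = (2^m, 0)`, the rightmost vertex of `SG m` (also a translation vector). -/
def a (m : ℕ) : ℝ × ℝ := ((2:ℝ) ^ m, 0)

/-- `b m = (2^(m-1), 2^(m-1)·√3)`, the topmost vertex of `SG m`. -/
def b (m : ℕ) : ℝ × ℝ := ((2:ℝ) ^ m / 2, (2:ℝ) ^ m / 2 * sq3)

/-- `c m = (3·2^(m-1), 2^(m-1)·√3)`. -/
def c (m : ℕ) : ℝ × ℝ := (3 * (2:ℝ) ^ m / 2, (2:ℝ) ^ m / 2 * sq3)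

/-- vertex set of `SG n` -/
def V : ℕ → Set (ℝ × ℝ)
  | 0 => {o, a 0, b 0}
  | n + 1 => V n ∪ ((· + a n) '' V n) ∪ ((· + b n) '' V n)

/-- edge set of `SG n` -/
def E : ℕ → Set (Sym2 (ℝ × ℝ))
  | 0 => {s(o, a 0), s(o, b 0), s(a 0, b 0)}
  | n + 1 => E n ∪ (Sym2.map (· + a n) '' E n) ∪ (Sym2.map (· + b n) '' E n)

/-- `SG n` as a simple graph on `ℝ × ℝ` -/
def G (n : ℕ) : SimpleGraph (ℝ × ℝ) := SimpleGraph.fromEdgeSet (E n)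

/-- a Hamiltonian path of `SG n`: a path visiting every vertex of `SG n` exactly once -/
def IsHamPath (n : ℕ) {u v : ℝ × ℝ} (p : (G n).Walk u v) : Prop :=
  p.IsPath ∧ ∀ x, x ∈ p.support ↔ x ∈ V n

/-- a Hamiltonian cycle of `SG n` -/
def IsHamCycle (n : ℕ) {u : ℝ × ℝ} (p : (G n).Walk u u) : Prop :=
  p.IsCycle ∧ ∀ x, x ∈ p.support ↔ x ∈ V n

/-- `f n u v`: the number of Hamiltonian paths of `SG n` with end-vertex set `{u, v}`
(for `u ≠ v`, such unordered paths correspond bijectively to walks from `u` to `v`). -/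
def f (n : ℕ) (u v : ℝ × ℝ) : ℕ := Nat.card {p : (G n).Walk u v // IsHamPath n p}

/-- `f1 n`: the number of Hamiltonian paths of `SG n` with end-vertex set `{o, a n}` -/
def f1 (n : ℕ) : ℕ := f n o (a n)

/-- the number of Hamiltonian cycles of `SG n`, counted up to starting vertex and
orientation: every Hamiltonian cycle passes through `o` and has exactly two
representatives as a closed walk based at `o`. -/
def HC (n : ℕ) : ℕ := Nat.card {p : (G n).Walk o o // IsHamCycle n p} / 2

/-- the number of Hamiltonian paths of `SG n` having `o` as one of their end vertices -/
def H0 (n : ℕ) : ℕ := ∑ᶠ x ∈ {x : ℝ × ℝ | x ≠ o}, f n o x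

/-- the total number of Hamiltonian paths of `SG n` (a path and its reversal
are the same unordered object, whence the division by `2`). -/
def H (n : ℕ) : ℕ := (∑ᶠ u : ℝ × ℝ, ∑ᶠ v : ℝ × ℝ, f n u v) / 2

/-- the distribution ratio `F(n,x) = f(n,x)/f1(n)` -/
def F (n : ℕ) (x : ℝ × ℝ) : ℝ := (f n o x : ℝ) / (f1 n : ℝ)

/-- `SG n` with the vertex `b n` (and its incident edges) deleted -/
def Gd (n : ℕ) : SimpleGraph (ℝ × ℝ) := SimpleGraph.fromEdgeSet {e ∈ E n | b n ∉ e}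

/-- Hamiltonian path of `SG n - b n` -/
def IsHamPathD (n : ℕ) {u v : ℝ × ℝ} (p : (Gd n).Walk u v) : Prop :=
  p.IsPath ∧ ∀ x, x ∈ p.support ↔ (x ∈ V n ∧ x ≠ b n)

/-- `g2 n x`: the number of Hamiltonian paths of `SG n - b n` with end-vertex set `{o, x}` -/
def g2 (n : ℕ) (x : ℝ × ℝ) : ℕ := Nat.card {p : (Gd n).Walk o x // IsHamPathD n p}

/-- `g1 n`: the number of Hamiltonian paths of `SG n - b n` with end-vertex set `{o, a n}` -/
def g1 (n : ℕ) : ℕ := g2 n (a n)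

/-- the distribution ratio `G₂(n,x) = g₂(n,x)/g₁(n)` -/
def G2 (n : ℕ) (x : ℝ × ℝ) : ℝ := (g2 n x : ℝ) / (g1 n : ℝ)

/-- mid-side vertex `a_{m,1} = (3·2^(m-1), 0)` -/
def a1 (m : ℕ) : ℝ × ℝ := (3 * (2:ℝ) ^ m / 2, 0)

/-- mid-side vertex `b_{m,1} = (5·2^(m-2), 2^(m-2)·√3)` -/
def b1 (m : ℕ) : ℝ × ℝ := (5 * (2:ℝ) ^ m / 4, (2:ℝ) ^ m / 4 * sq3)

/-- mid-side vertex `c_{m,1} = (7·2^(m-2), 2^(m-2)·√3)` -/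
def c1 (m : ℕ) : ℝ × ℝ := (7 * (2:ℝ) ^ m / 4, (2:ℝ) ^ m / 4 * sq3)

/-- mid-side vertex `a_{m,2} = (2^m, 2^(m-1)·√3)` -/
def a2 (m : ℕ) : ℝ × ℝ := ((2:ℝ) ^ m, (2:ℝ) ^ m / 2 * sq3)

/-- mid-side vertex `b_{m,2} = (3·2^(m-2), 3·2^(m-2)·√3)` -/
def b2 (m : ℕ) : ℝ × ℝ := (3 * (2:ℝ) ^ m / 4, 3 * (2:ℝ) ^ m / 4 * sq3)

/-- mid-side vertex `c_{m,2} = (5·2^(m-2), 3·2^(m-2)·√3)` -/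
def c2 (m : ℕ) : ℝ × ℝ := (5 * (2:ℝ) ^ m / 4, 3 * (2:ℝ) ^ m / 4 * sq3)

/-- exceptional vertex `a* = (2^(n-1), (2^(n-1)-1)·√3)` -/
def astar (n : ℕ) : ℝ × ℝ := ((2:ℝ) ^ n / 2, ((2:ℝ) ^ n / 2 - 1) * sq3)

/-- exceptional vertex `b* = (2^(n-1) - 1/2, (2^n-1)·√3/2)` -/
def bstar (n : ℕ) : ℝ × ℝ := ((2:ℝ) ^ n / 2 - 1/2, ((2:ℝ) ^ n - 1) * sq3 / 2)

/-- exceptional vertex `c* = (2^(n-1) + 1/2, (2^n-1)·√3/2)` -/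
def cstar (n : ℕ) : ℝ × ℝ := ((2:ℝ) ^ n / 2 + 1/2, ((2:ℝ) ^ n - 1) * sq3 / 2)

/-- the Euclidean norm on `ℝ × ℝ` -/
def enorm (x : ℝ × ℝ) : ℝ := Real.sqrt (x.1 ^ 2 + x.2 ^ 2)

/-- the set `C n` of corner vertices of `SG n` -/
def C (n : ℕ) : Finset (ℝ × ℝ) :=
  ((Finset.range (n + 1)).image a) ∪ ((Finset.range (n + 1)).image b) ∪
    ((Finset.range n).image c)

/-- the mean `ℓ` displacement over the corner vertices -/
def xi' (n : ℕ) (ℓ : ℝ) : ℝ :=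
  (∑ x ∈ C n, enorm x ^ ℓ * F n x) / (∑ x ∈ C n, F n x)

/-- `p(n,x)`: the probability that a Hamiltonian path with one end at `o`
has its other end at `x` -/
def p (n : ℕ) (x : ℝ × ℝ) : ℝ := (f n o x : ℝ) / (H0 n : ℝ)

/-- the mean `ℓ` displacement of Hamiltonian paths on `SG n` with one end at `o` -/
def xi (n : ℕ) (ℓ : ℝ) : ℝ :=
  ∑ᶠ x ∈ {x : ℝ × ℝ | x ∈ V n ∧ x ≠ o}, enorm x ^ ℓ * p n x

/-- the partition function of Hamiltonian paths on `SG n` -/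
def Z (n : ℕ) (β : ℝ) : ℝ := (H n : ℝ) * Real.exp (-(β * ((3 ^ (n + 1) + 1) / 2)))

/-- The three outmost vertices of `SG n`; they are also the translation vectors from `SG n` to its
three copies inside `SG (n + 1)`. -/
def corner (n : ℕ) : Fin 3 → ℝ × ℝ := ![o, a n, b n]

lemma sq3_pos : 0 < sq3 := Real.sqrt_pos.2 (by norm_num)

lemma mem_V_succ {n : ℕ} {x : ℝ × ℝ} :
    x ∈ V (n + 1) ↔ ∃ c, ∃ y ∈ V n, y + corner n c = x := by
  have h0 : corner n 0 = 0 := rfl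
  have h1 : corner n 1 = a n := rfl
  have h2 : corner n 2 = b n := rfl
  simp only [V, Set.mem_union, Set.mem_image, Fin.exists_fin_succ, Fin.succ_zero_eq_one,
    Fin.succ_one_eq_two, h0, h1, h2, add_zero, exists_eq_right, or_assoc, IsEmpty.exists_iff,
    or_false]

lemma mem_E_succ {n : ℕ} {e : Sym2 (ℝ × ℝ)} :
    e ∈ E (n + 1) ↔ ∃ c, ∃ e' ∈ E n, e'.map (· + corner n c) = e := by
  have h : ∀ e : Sym2 (ℝ × ℝ), e.map (fun x => x) = e := fun e => by
    induction e using Sym2.ind with | _ x y => simp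
  have h0 : corner n 0 = 0 := rfl
  have h1 : corner n 1 = a n := rfl
  have h2 : corner n 2 = b n := rfl
  simp only [E, Set.mem_union, Set.mem_image, Fin.exists_fin_succ, Fin.succ_zero_eq_one,
    Fin.succ_one_eq_two, h0, h1, h2, h, add_zero, exists_eq_right, or_assoc, IsEmpty.exists_iff,
    or_false]

lemma corner_succ (n : ℕ) (c : Fin 3) : corner (n + 1) c = corner n c + corner n c := by
  fin_cases c <;> simp [corner, o, a, b, pow_succ] <;> ring_nf

lemma mem_V_zero {x : ℝ × ℝ} : x ∈ V 0 ↔ ∃ c, corner 0 c = x := by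
  simp [V, corner, Fin.exists_fin_succ, eq_comm]

lemma corner_mem_V (n : ℕ) (c : Fin 3) : corner n c ∈ V n := by
  induction n with
  | zero => exact mem_V_zero.2 ⟨c, rfl⟩
  | succ n ih => exact mem_V_succ.2 ⟨c, _, ih, (corner_succ n c).symm⟩

lemma corner_injective (n : ℕ) : Function.Injective (corner n) := by
  have h2 : (0 : ℝ) < 2 ^ n := by positivity
  have h3 := sq3_pos
  intro c d h
  fin_cases c <;> fin_cases d <;> first
    | rfl
    | (exfalso
       simp [corner, o, a, b, Prod.ext_iff, h2.ne, h2.ne', h3.ne'] at h)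

lemma mem_triangle {n : ℕ} {x : ℝ × ℝ} (hx : x ∈ V n) :
    0 ≤ x.2 ∧ x.2 ≤ sq3 * x.1 ∧ sq3 * x.1 + x.2 ≤ sq3 * 2 ^ n := by
  have h3 := sq3_pos
  induction n generalizing x with
  | zero =>
    obtain ⟨c, rfl⟩ := mem_V_zero.1 hx
    fin_cases c <;> dsimp [corner, o, a, b] <;> refine ⟨?_, ?_, ?_⟩ <;> nlinarith
  | succ n ih =>
    obtain ⟨c, y, hy, rfl⟩ := mem_V_succ.1 hx
    obtain ⟨h₁, h₂, h₃⟩ := ih hy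
    have h4 : 0 < sq3 * 2 ^ n := by positivity
    fin_cases c <;> simp [corner, o, a, b, pow_succ] <;> refine ⟨?_, ?_, ?_⟩ <;> nlinarith

/-- Distinct copies of `SG n` inside `SG (n + 1)` share one vertex only. -/
lemma eq_corner_of_add_eq {n : ℕ} {c d : Fin 3} (hcd : c ≠ d) {x y : ℝ × ℝ} (hx : x ∈ V n)
    (hy : y ∈ V n) (h : x + corner n c = y + corner n d) : x = corner n d ∧ y = corner n c := by
  have h3 := sq3_pos
  obtain ⟨h₁, h₂, h₃⟩ := mem_triangle hx
  obtain ⟨h₄, h₅, h₆⟩ := mem_triangle hy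
  have e1 : (x + corner n c).1 = (y + corner n d).1 := by rw [h]
  have e2 : (x + corner n c).2 = (y + corner n d).2 := by rw [h]
  have key : ∀ {z w : ℝ × ℝ}, sq3 * z.1 = sq3 * w.1 → z.2 = w.2 → z = w := fun h₁ h₂ =>
    Prod.ext (mul_left_cancel₀ h3.ne' h₁) h₂
  fin_cases c <;> fin_cases d <;> first
    | exact absurd rfl hcd
    | (simp [corner, o, a, b] at e1 e2
       have e3 : sq3 * _ = sq3 * _ := congrArg (sq3 * ·) e1
       constructor <;> apply key <;> dsimp [corner, o, a, b] <;> linarith)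

lemma V_finite (n : ℕ) : (V n).Finite := by
  induction n with
  | zero => simp [V]
  | succ n ih => exact (ih.union (ih.image _)).union (ih.image _)

lemma E_finite (n : ℕ) : (E n).Finite := by
  induction n with
  | zero => simp [E]
  | succ n ih => exact (ih.union (ih.image _)).union (ih.image _)

lemma mem_E_zero {e : Sym2 (ℝ × ℝ)} :
    e ∈ E 0 ↔ ∃ c d, c ≠ d ∧ s(corner 0 c, corner 0 d) = e := by
  constructor
  · rintro (rfl | rfl | rfl)
    · exact ⟨0, 1, by decide, rfl⟩
    · exact ⟨0, 2, by decide, rfl⟩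
    · exact ⟨1, 2, by decide, rfl⟩
  · rintro ⟨c, d, hcd, rfl⟩
    fin_cases c <;> fin_cases d <;> first
      | exact absurd rfl hcd
      | simp [E, corner, Sym2.eq_swap]

lemma ne_and_mem_of_mem_E {n : ℕ} {x y : ℝ × ℝ} (h : s(x, y) ∈ E n) :
    x ≠ y ∧ x ∈ V n ∧ y ∈ V n := by
  induction n generalizing x y with
  | zero =>
    obtain ⟨c, d, hcd, h⟩ := mem_E_zero.1 h
    have h' := (corner_injective 0).ne hcd
    rcases Sym2.eq_iff.1 h with ⟨rfl, rfl⟩ | ⟨rfl, rfl⟩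
    · exact ⟨h', corner_mem_V _ _, corner_mem_V _ _⟩
    · exact ⟨h'.symm, corner_mem_V _ _, corner_mem_V _ _⟩
  | succ n ih =>
    obtain ⟨c, e, he, h⟩ := mem_E_succ.1 h
    induction e using Sym2.ind with
    | _ u v =>
      obtain ⟨h₁, h₂, h₃⟩ := ih he
      have hu := mem_V_succ.2 ⟨c, u, h₂, rfl⟩
      have hv := mem_V_succ.2 ⟨c, v, h₃, rfl⟩
      have h' : u + corner n c ≠ v + corner n c := fun h => h₁ (add_right_cancel h)
      rw [Sym2.map_mk] at h
      rcases Sym2.eq_iff.1 h with ⟨rfl, rfl⟩ | ⟨rfl, rfl⟩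
      · exact ⟨h', hu, hv⟩
      · exact ⟨h'.symm, hv, hu⟩

lemma mem_V_of_mem_E {n : ℕ} {e : Sym2 (ℝ × ℝ)} (he : e ∈ E n) {x : ℝ × ℝ} (hx : x ∈ e) :
    x ∈ V n := by
  obtain ⟨y, rfl⟩ := hx
  exact (ne_and_mem_of_mem_E he).2.1

/-- The vertex set of `SG n` as a finset. -/
def VF (n : ℕ) : Finset (ℝ × ℝ) := (V_finite n).toFinset

/-- The edge set of `SG n` as a finset. -/
def EF (n : ℕ) : Finset (Sym2 (ℝ × ℝ)) := (E_finite n).toFinset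

@[simp] lemma mem_VF {n : ℕ} {x : ℝ × ℝ} : x ∈ VF n ↔ x ∈ V n := by simp [VF]

@[simp] lemma mem_EF {n : ℕ} {e : Sym2 (ℝ × ℝ)} : e ∈ EF n ↔ e ∈ E n := by simp [EF]

/-- The degree of the vertex `v` in the graph with edge set `S`. -/
def deg (S : Finset (Sym2 (ℝ × ℝ))) (v : ℝ × ℝ) : ℕ := (S.filter (v ∈ ·)).card

lemma deg_mono {S T : Finset (Sym2 (ℝ × ℝ))} (h : S ⊆ T) (v : ℝ × ℝ) : deg S v ≤ deg T v :=
  Finset.card_le_card (Finset.filter_subset_filter _ h)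

/-- Every nonempty set of edges in `S` has a leaf: `S` contains no cycles. -/
def IsForest (S : Finset (Sym2 (ℝ × ℝ))) : Prop :=
  ∀ T ⊆ S, T.Nonempty → ∃ v, deg T v = 1

/-- The part of `S` lying in the `c`-th copy of `SG n` inside `SG (n + 1)`, translated back. -/
def restrict (n : ℕ) (c : Fin 3) (S : Finset (Sym2 (ℝ × ℝ))) : Finset (Sym2 (ℝ × ℝ)) :=
  (EF n).filter (fun e => e.map (· + corner n c) ∈ S)

lemma map_add_injective (t : ℝ × ℝ) :
    Function.Injective (Sym2.map (· + t) : Sym2 (ℝ × ℝ) → Sym2 (ℝ × ℝ)) :=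
  Sym2.map.injective (add_left_injective t)

lemma mem_map_add {t v : ℝ × ℝ} {e : Sym2 (ℝ × ℝ)} : v ∈ e.map (· + t) ↔ v - t ∈ e := by
  rw [Sym2.mem_map]
  constructor
  · rintro ⟨x, hx, rfl⟩
    simpa using hx
  · intro h
    exact ⟨_, h, by simp⟩

lemma eq_of_map_add_eq {n : ℕ} {c d : Fin 3} {e e' : Sym2 (ℝ × ℝ)} (he : e ∈ E n) (he' : e' ∈ E n)
    (h : e.map (· + corner n c) = e'.map (· + corner n d)) : c = d := by
  by_contra hcd
  have key : ∀ x ∈ e, x = corner n d := by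
    intro x hx
    have h₁ : x + corner n c ∈ e'.map (· + corner n d) := h ▸ Sym2.mem_map.2 ⟨x, hx, rfl⟩
    obtain ⟨y, hy, hxy⟩ := Sym2.mem_map.1 h₁
    exact (eq_corner_of_add_eq hcd (mem_V_of_mem_E he hx) (mem_V_of_mem_E he' hy) hxy.symm).1
  induction e using Sym2.ind with
  | _ x y =>
    exact (ne_and_mem_of_mem_E he).1 ((key x (by simp)).trans (key y (by simp)).symm)

lemma deg_image_map_add (S : Finset (Sym2 (ℝ × ℝ))) (t v : ℝ × ℝ) :
    deg (S.image (Sym2.map (· + t))) v = deg S (v - t) := by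
  unfold deg
  rw [Finset.filter_image, Finset.card_image_of_injective _ (map_add_injective t)]
  simp only [mem_map_add]

lemma image_restrict_subset (n : ℕ) (c : Fin 3) (S : Finset (Sym2 (ℝ × ℝ))) :
    (restrict n c S).image (Sym2.map (· + corner n c)) ⊆ S := by
  intro e he
  obtain ⟨e', he', rfl⟩ := Finset.mem_image.1 he
  exact (Finset.mem_filter.1 he').2

lemma restrict_subset (n : ℕ) (c : Fin 3) (S : Finset (Sym2 (ℝ × ℝ))) : restrict n c S ⊆ EF n :=
  Finset.filter_subset _ _

lemma eq_biUnion_restrict {n : ℕ} {S : Finset (Sym2 (ℝ × ℝ))} (hS : S ⊆ EF (n + 1)) :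
    S = Finset.univ.biUnion (fun c => (restrict n c S).image (Sym2.map (· + corner n c))) := by
  apply Finset.Subset.antisymm
  · intro e he
    obtain ⟨c, e', he', rfl⟩ := mem_E_succ.1 (mem_EF.1 (hS he))
    simp only [Finset.mem_biUnion, Finset.mem_univ, true_and, Finset.mem_image]
    exact ⟨c, e', Finset.mem_filter.2 ⟨mem_EF.2 he', he⟩, rfl⟩
  · exact Finset.biUnion_subset.2 fun c _ => image_restrict_subset n c S

lemma deg_eq_sum_restrict {n : ℕ} {S : Finset (Sym2 (ℝ × ℝ))} (hS : S ⊆ EF (n + 1)) (v : ℝ × ℝ) :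
    deg S v = ∑ c, deg (restrict n c S) (v - corner n c) := by
  conv_lhs => rw [eq_biUnion_restrict hS]
  rw [deg, Finset.filter_biUnion, Finset.card_biUnion]
  · exact Finset.sum_congr rfl fun c _ => deg_image_map_add _ _ _
  · intro c _ d _ hcd
    refine Finset.disjoint_left.2 fun e he he' => hcd ?_
    obtain ⟨e₁, h₁, rfl⟩ := Finset.mem_image.1 (Finset.mem_filter.1 he).1
    obtain ⟨e₂, h₂, h⟩ := Finset.mem_image.1 (Finset.mem_filter.1 he').1
    exact eq_of_map_add_eq (mem_EF.1 (restrict_subset _ _ _ h₁))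
      (mem_EF.1 (restrict_subset _ _ _ h₂)) h.symm

lemma mem_V_of_deg_ne_zero {n : ℕ} {S : Finset (Sym2 (ℝ × ℝ))} (hS : S ⊆ EF n) {v : ℝ × ℝ}
    (h : deg S v ≠ 0) : v ∈ V n := by
  obtain ⟨e, he⟩ := Finset.card_ne_zero.1 h
  obtain ⟨he, hv⟩ := Finset.mem_filter.1 he
  exact mem_V_of_mem_E (mem_EF.1 (hS he)) hv

lemma deg_restrict_le (n : ℕ) (c : Fin 3) (S : Finset (Sym2 (ℝ × ℝ))) (v : ℝ × ℝ) :
    deg (restrict n c S) v ≤ deg S (v + corner n c) := by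
  have h := deg_mono (image_restrict_subset n c S) (v + corner n c)
  rwa [deg_image_map_add, add_sub_cancel_right] at h

/-- A vertex of one copy which is not an outmost vertex of that copy belongs to no other copy. -/
lemma deg_eq_restrict_of_forall_ne {n : ℕ} {S : Finset (Sym2 (ℝ × ℝ))} (hS : S ⊆ EF (n + 1))
    {c : Fin 3} {x : ℝ × ℝ} (hx : x ∈ V n) (h : ∀ d, d ≠ c → x ≠ corner n d) :
    deg S (x + corner n c) = deg (restrict n c S) x := by
  rw [deg_eq_sum_restrict hS, Finset.sum_eq_single c, add_sub_cancel_right]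
  · intro d _ hd
    by_contra h0
    have h₁ := mem_V_of_deg_ne_zero (restrict_subset _ _ _) h0
    exact h d hd (eq_corner_of_add_eq hd.symm hx h₁ (by simp)).1
  · simp

lemma deg_corner {n : ℕ} {S : Finset (Sym2 (ℝ × ℝ))} (hS : S ⊆ EF (n + 1)) (c : Fin 3) :
    deg S (corner (n + 1) c) = deg (restrict n c S) (corner n c) := by
  rw [corner_succ]
  exact deg_eq_restrict_of_forall_ne hS (corner_mem_V n c)
    fun d hd h => hd (corner_injective n h).symm

lemma deg_junction {n : ℕ} {S : Finset (Sym2 (ℝ × ℝ))} (hS : S ⊆ EF (n + 1)) {c d : Fin 3}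
    (hcd : c ≠ d) : deg S (corner n c + corner n d) =
      deg (restrict n c S) (corner n d) + deg (restrict n d S) (corner n c) := by
  rw [deg_eq_sum_restrict hS, ← Finset.sum_subset (Finset.subset_univ {c, d}),
    Finset.sum_pair hcd, add_sub_cancel_left, add_sub_cancel_right]
  intro k _ hk
  simp only [Finset.mem_insert, Finset.mem_singleton, not_or] at hk
  by_contra h0
  have h₁ := mem_V_of_deg_ne_zero (restrict_subset _ _ _) h0
  have h₂ := (eq_corner_of_add_eq (Ne.symm hk.2) (corner_mem_V n c) h₁ (by simp)).1
  exact hk.1 (corner_injective n h₂).symm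

lemma IsForest.mono {S T : Finset (Sym2 (ℝ × ℝ))} (hT : IsForest T) (h : S ⊆ T) : IsForest S :=
  fun U hU => hT U (hU.trans h)

lemma IsForest.restrict {S : Finset (Sym2 (ℝ × ℝ))} (hS : IsForest S) (n : ℕ) (c : Fin 3) :
    IsForest (restrict n c S) := by
  intro T hT hT'
  obtain ⟨v, hv⟩ := hS (T.image (Sym2.map (· + corner n c)))
    ((Finset.image_subset_image hT).trans (image_restrict_subset n c S)) (hT'.image _)
  exact ⟨_, (deg_image_map_add _ _ _).symm.trans hv⟩

/-- A junction of two copies is not an outmost vertex. -/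
lemma junction_ne_corner {n : ℕ} {c d : Fin 3} (hcd : c ≠ d) (k : Fin 3) :
    corner n c + corner n d ≠ corner (n + 1) k := by
  intro h
  rw [corner_succ] at h
  have key : ∀ {c d : Fin 3}, c ≠ d → d ≠ k → corner n c + corner n d ≠ corner n k + corner n k :=
    fun hcd hdk h => hcd (corner_injective n
      ((eq_corner_of_add_eq hdk (corner_mem_V n _) (corner_mem_V n _) h).1.trans
        (eq_corner_of_add_eq hdk (corner_mem_V n _) (corner_mem_V n _) h).2))
  by_cases hdk : d = k
  · exact key hcd.symm (fun hck => hcd (hck.trans hdk.symm)) (by rwa [add_comm])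
  · exact key hcd hdk h

lemma junction_mem_V (n : ℕ) (c d : Fin 3) : corner n c + corner n d ∈ V (n + 1) :=
  mem_V_succ.2 ⟨d, _, corner_mem_V n c, rfl⟩

/-- The vertices of `SG n`, other than the outmost ones, whose degree in `S` is not `2`. -/
def defects (n : ℕ) (S : Finset (Sym2 (ℝ × ℝ))) : Finset (ℝ × ℝ) :=
  (VF n).filter (fun v => (∀ c, v ≠ corner n c) ∧ deg S v ≠ 2)

lemma mem_defects {n : ℕ} {S : Finset (Sym2 (ℝ × ℝ))} {v : ℝ × ℝ} :
    v ∈ defects n S ↔ v ∈ V n ∧ (∀ c, v ≠ corner n c) ∧ deg S v ≠ 2 := by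
  simp [defects]

lemma sum_card_defects_restrict_le {n : ℕ} {S : Finset (Sym2 (ℝ × ℝ))} (hS : S ⊆ EF (n + 1)) :
    ∑ c, (defects n (restrict n c S)).card ≤ (defects (n + 1) S).card := by
  have h : ∀ c, (defects n (restrict n c S)).card =
      ((defects n (restrict n c S)).image (· + corner n c)).card := fun c =>
    (Finset.card_image_of_injective _ (add_left_injective _)).symm
  rw [Finset.sum_congr rfl fun c _ => h c, ← Finset.card_biUnion]
  · refine Finset.card_le_card (Finset.biUnion_subset.2 fun c _ v hv => ?_)
    obtain ⟨x, hx, rfl⟩ := Finset.mem_image.1 hv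
    obtain ⟨h₁, h₂, h₃⟩ := mem_defects.1 hx
    refine mem_defects.2 ⟨mem_V_succ.2 ⟨c, x, h₁, rfl⟩, fun d hd => ?_, ?_⟩
    · rw [corner_succ] at hd
      by_cases hcd : c = d
      · subst hcd
        exact h₂ c (add_right_cancel hd)
      · exact h₂ d (eq_corner_of_add_eq hcd h₁ (corner_mem_V n d) hd).1
    · rwa [deg_eq_restrict_of_forall_ne hS h₁ fun d _ => h₂ d]
  · intro c _ d _ hcd
    refine Finset.disjoint_left.2 fun v hv hv' => ?_
    obtain ⟨x, hx, rfl⟩ := Finset.mem_image.1 hv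
    obtain ⟨y, hy, h⟩ := Finset.mem_image.1 hv'
    exact (mem_defects.1 hx).2.1 d (eq_corner_of_add_eq hcd (mem_defects.1 hx).1
      (mem_defects.1 hy).1 h.symm).1

/-- The linear forests in `SG n` with at most `D` defects. -/
def conf (n D : ℕ) : Finset (Finset (Sym2 (ℝ × ℝ))) :=
  (EF n).powerset.filter (fun S => IsForest S ∧ (∀ v, deg S v ≤ 2) ∧ (defects n S).card ≤ D)

lemma mem_conf {n D : ℕ} {S : Finset (Sym2 (ℝ × ℝ))} : S ∈ conf n D ↔
    S ⊆ EF n ∧ IsForest S ∧ (∀ v, deg S v ≤ 2) ∧ (defects n S).card ≤ D := by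
  simp [conf]

lemma restrict_mem_conf {n D : ℕ} {S : Finset (Sym2 (ℝ × ℝ))} (hS : S ∈ conf (n + 1) D)
    (c : Fin 3) : restrict n c S ∈ conf n (defects n (restrict n c S)).card :=
  mem_conf.2 ⟨restrict_subset _ _ _, (mem_conf.1 hS).2.1.restrict n c,
    fun v => (deg_restrict_le n c S v).trans ((mem_conf.1 hS).2.2.1 _), le_rfl⟩

lemma conf_mono (n : ℕ) {D D' : ℕ} (h : D ≤ D') : conf n D ⊆ conf n D' := fun _ hS =>
  mem_conf.2 ⟨(mem_conf.1 hS).1, (mem_conf.1 hS).2.1, (mem_conf.1 hS).2.2.1,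
    (mem_conf.1 hS).2.2.2.trans h⟩

lemma card_le_sum_prod_card {ι α β : Type*} [Fintype ι] {A : Finset α} (r : ι → α → β)
    (hr : ∀ s ∈ A, ∀ t ∈ A, (∀ c, r c s = r c t) → s = t) {κ : Type*} (X : Finset κ)
    (B : κ → ι → Finset β) (h : ∀ s ∈ A, ∃ x ∈ X, ∀ c, r c s ∈ B x c) :
    A.card ≤ ∑ x ∈ X, ∏ c, (B x c).card := by
  calc A.card = (A.image fun s c => r c s).card := by
        refine (Finset.card_image_of_injOn fun s hs t ht hst => ?_).symm
        exact hr s hs t ht fun c => congrFun hst c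
    _ ≤ (X.biUnion fun x => Fintype.piFinset (B x)).card := by
        refine Finset.card_le_card (Finset.image_subset_iff.2 fun s hs => ?_)
        obtain ⟨x, hx, hx'⟩ := h s hs
        exact Finset.mem_biUnion.2 ⟨x, hx, Fintype.mem_piFinset.2 hx'⟩
    _ ≤ ∑ x ∈ X, (Fintype.piFinset (B x)).card := Finset.card_biUnion_le
    _ = _ := by simp only [Fintype.card_piFinset]

lemma eq_of_restrict_eq {n : ℕ} {S T : Finset (Sym2 (ℝ × ℝ))} (hS : S ⊆ EF (n + 1))
    (hT : T ⊆ EF (n + 1)) (h : ∀ c, restrict n c S = restrict n c T) : S = T := by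
  rw [eq_biUnion_restrict hS, eq_biUnion_restrict hT]
  simp only [h]

lemma card_conf_succ_le (n D : ℕ) (X : Finset (Fin 3 → ℕ))
    (hX : ∀ k : Fin 3 → ℕ, ∑ c, k c ≤ D → ∃ x ∈ X, k ≤ x) :
    (conf (n + 1) D).card ≤ ∑ x ∈ X, ∏ c, (conf n (x c)).card := by
  refine card_le_sum_prod_card (fun c S => restrict n c S) (fun S hS T hT h =>
    eq_of_restrict_eq (mem_conf.1 hS).1 (mem_conf.1 hT).1 h) X (fun x c => conf n (x c))
    fun S hS => ?_
  obtain ⟨x, hx, hx'⟩ := hX (fun c => (defects n (restrict n c S)).card)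
    ((sum_card_defects_restrict_le (mem_conf.1 hS).1).trans (mem_conf.1 hS).2.2.2)
  exact ⟨x, hx, fun c => conf_mono n (hx' c) (restrict_mem_conf hS c)⟩

lemma sum_deg {n : ℕ} {S : Finset (Sym2 (ℝ × ℝ))} (hS : S ⊆ EF n) :
    ∑ v ∈ VF n, deg S v = 2 * S.card := by
  simp only [deg, Finset.card_filter]
  rw [Finset.sum_comm, Finset.sum_const_nat (m := 2), mul_comm]
  intro e he
  have he' := mem_EF.1 (hS he)
  rw [← Finset.card_filter]
  induction e using Sym2.ind with
  | _ x y =>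
    obtain ⟨hxy, hx, hy⟩ := ne_and_mem_of_mem_E he'
    rw [← Finset.card_pair hxy]
    congr 1
    ext v
    simp only [Finset.mem_filter, mem_VF, Sym2.mem_iff, Finset.mem_insert, Finset.mem_singleton]
    constructor
    · exact fun h => h.2
    · rintro (rfl | rfl)
      · exact ⟨hx, Or.inl rfl⟩
      · exact ⟨hy, Or.inr rfl⟩

lemma deg_eq_two {n : ℕ} {S : Finset (Sym2 (ℝ × ℝ))} (hS : S ∈ conf n 0) {v : ℝ × ℝ}
    (hv : v ∈ V n) (h : ∀ c, v ≠ corner n c) : deg S v = 2 := by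
  by_contra h2
  have h0 := Finset.card_eq_zero.1 (Nat.le_zero.1 (mem_conf.1 hS).2.2.2)
  simpa [h0] using mem_defects.2 ⟨hv, h, h2⟩

lemma even_sum_deg_corner {n : ℕ} {S : Finset (Sym2 (ℝ × ℝ))} (hS : S ∈ conf n 0) :
    Even (∑ c, deg S (corner n c)) := by
  have h := sum_deg (mem_conf.1 hS).1
  have hsub : Finset.univ.image (corner n) ⊆ VF n := by
    intro v hv
    obtain ⟨c, _, rfl⟩ := Finset.mem_image.1 hv
    exact mem_VF.2 (corner_mem_V n c)
  rw [← Finset.sum_sdiff hsub, Finset.sum_image (corner_injective n).injOn,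
    Finset.sum_const_nat (m := 2)] at h
  · rw [Nat.even_iff]
    omega
  · intro v hv
    simp only [Finset.mem_sdiff, mem_VF, Finset.mem_image, Finset.mem_univ, true_and,
      not_exists] at hv
    exact deg_eq_two hS hv.1 fun c => Ne.symm (hv.2 c)

/-- The numbers of Hamiltonian paths between two outmost vertices of `SG n` and of `SG n` with
the third outmost vertex deleted. -/
def pathCount : ℕ → ℕ × ℕ
  | 0 => (1, 1)
  | n + 1 =>
    (2 * (pathCount n).1 ^ 2 * (pathCount n).2,
      2 * (pathCount n).1 * (pathCount n).2 ^ 2 + if n = 0 then 1 else 0)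

/-- The possible degrees of the outmost vertices in a linear forest without defects,
and the number of such forests. -/
def typeBound (n : ℕ) : ℕ → ℕ → ℕ → ℕ
  | 1, 1, 2 => (pathCount n).1
  | 1, 2, 1 => (pathCount n).1
  | 2, 1, 1 => (pathCount n).1
  | 1, 1, 0 => (pathCount n).2
  | 1, 0, 1 => (pathCount n).2
  | 0, 1, 1 => (pathCount n).2
  | 0, 0, 0 => if n = 0 then 1 else 0
  | _, _, _ => 0

/-- The linear forests in `SG n` without defects and with given degrees at the outmost vertices. -/
def typedConf (n x y z : ℕ) : Finset (Finset (Sym2 (ℝ × ℝ))) :=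
  (conf n 0).filter fun S =>
    deg S (corner n 0) = x ∧ deg S (corner n 1) = y ∧ deg S (corner n 2) = z

lemma corner_deg_cases {n : ℕ} {S : Finset (Sym2 (ℝ × ℝ))} (hS : S ∈ conf n 0) {x y z : ℕ}
    (hx : deg S (corner n 0) = x) (hy : deg S (corner n 1) = y) (hz : deg S (corner n 2) = z) :
    (x, y, z) ∈ [(1, 1, 2), (1, 2, 1), (2, 1, 1), (1, 1, 0), (1, 0, 1), (0, 1, 1)] ∨
      (x, y, z) = (0, 0, 0) ∧ n = 0 := by
  obtain ⟨h₁, h₂, h₃, -⟩ := mem_conf.1 hS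
  rcases S.eq_empty_or_nonempty with rfl | hne
  · refine Or.inr ⟨?_, ?_⟩
    · subst hx hy hz
      simp [deg]
    · by_contra hn
      obtain ⟨m, rfl⟩ := Nat.exists_eq_succ_of_ne_zero hn
      have h := deg_eq_two hS (junction_mem_V m 0 1) (junction_ne_corner (by decide))
      simp [deg] at h
  · refine Or.inl ?_
    have hev := even_sum_deg_corner hS
    rw [Fin.sum_univ_three, hx, hy, hz] at hev
    have hx2 := hx ▸ h₃ (corner n 0)
    have hy2 := hy ▸ h₃ (corner n 1)
    have hz2 := hz ▸ h₃ (corner n 2)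
    have h1 : x = 1 ∨ y = 1 ∨ z = 1 := by
      obtain ⟨v, hv⟩ := h₂ S subset_rfl hne
      have hvV := mem_V_of_deg_ne_zero h₁ (v := v) (by omega)
      by_contra hcon
      have h2 := deg_eq_two hS hvV fun c hc => hcon (by
        subst hc
        fin_cases c
        · exact Or.inl (hx.symm.trans hv)
        · exact Or.inr (Or.inl (hy.symm.trans hv))
        · exact Or.inr (Or.inr (hz.symm.trans hv)))
      omega
    clear hx hy hz
    interval_cases x <;> interval_cases y <;> interval_cases z <;> revert h1 hev <;> decide

lemma card_typedConf_succ_le (n x y z : ℕ) :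
    (typedConf (n + 1) x y z).card ≤ ∑ t ∈ Finset.range 3 ×ˢ Finset.range 3 ×ˢ Finset.range 3,
      (typedConf n x t.1 t.2.1).card * (typedConf n (2 - t.1) y t.2.2).card *
        (typedConf n (2 - t.2.1) (2 - t.2.2) z).card := by
  refine (card_le_sum_prod_card (fun c S => restrict n c S) (fun S hS T hT h =>
    eq_of_restrict_eq (mem_conf.1 (Finset.mem_filter.1 hS).1).1
      (mem_conf.1 (Finset.mem_filter.1 hT).1).1 h)
    (Finset.range 3 ×ˢ Finset.range 3 ×ˢ Finset.range 3)
    (fun t => ![typedConf n x t.1 t.2.1, typedConf n (2 - t.1) y t.2.2,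
      typedConf n (2 - t.2.1) (2 - t.2.2) z]) fun S hS => ?_).trans_eq ?_
  · obtain ⟨hS, hx, hy, hz⟩ := Finset.mem_filter.1 hS
    have hsub := (mem_conf.1 hS).1
    have h2 := (mem_conf.1 hS).2.2.1
    have hj : ∀ c d : Fin 3, c ≠ d → deg (restrict n c S) (corner n d) +
        deg (restrict n d S) (corner n c) = 2 := fun c d hcd => by
      rw [← deg_junction hsub hcd]
      exact deg_eq_two hS (junction_mem_V n c d) (junction_ne_corner hcd)
    have h01 := hj 0 1 (by decide)
    have h02 := hj 0 2 (by decide)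
    have h12 := hj 1 2 (by decide)
    have h01' : deg (restrict n 1 S) (corner n 0) = 2 - deg (restrict n 0 S) (corner n 1) := by
      omega
    have h02' : deg (restrict n 2 S) (corner n 0) = 2 - deg (restrict n 0 S) (corner n 2) := by
      omega
    have h12' : deg (restrict n 2 S) (corner n 1) = 2 - deg (restrict n 1 S) (corner n 2) := by
      omega
    rw [deg_corner hsub] at hx hy hz
    have hd : ∀ c, restrict n c S ∈ conf n 0 := fun c => by
      have h := sum_card_defects_restrict_le hsub
      have h' := Finset.single_le_sum (f := fun c => (defects n (restrict n c S)).card)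
        (fun _ _ => Nat.zero_le _) (Finset.mem_univ c)
      have h0 : (defects n (restrict n c S)).card ≤ 0 := (h'.trans h).trans (mem_conf.1 hS).2.2.2
      exact conf_mono n h0 (restrict_mem_conf hS c)
    refine ⟨(deg (restrict n 0 S) (corner n 1), deg (restrict n 0 S) (corner n 2),
      deg (restrict n 1 S) (corner n 2)), ?_, fun c => ?_⟩
    · simp only [Finset.mem_product, Finset.mem_range]
      omega
    · fin_cases c
      · exact Finset.mem_filter.2 ⟨hd 0, hx, rfl, rfl⟩
      · exact Finset.mem_filter.2 ⟨hd 1, h01', hy, rfl⟩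
      · exact Finset.mem_filter.2 ⟨hd 2, h02', h12', hz⟩
  · refine Finset.sum_congr rfl fun t _ => ?_
    rw [Fin.prod_univ_three]
    rfl

lemma deg_corner_zero {S : Finset (Sym2 (ℝ × ℝ))} (hS : S ⊆ EF 0) {i j k : Fin 3} (hij : i ≠ j)
    (hik : i ≠ k) (hjk : j ≠ k) : deg S (corner 0 i) =
      (if s(corner 0 i, corner 0 j) ∈ S then 1 else 0) +
        (if s(corner 0 i, corner 0 k) ∈ S then 1 else 0) := by
  have inj : ∀ {c d}, corner 0 c = corner 0 d ↔ c = d := (corner_injective 0).eq_iff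
  have h : S.filter (corner 0 i ∈ ·) =
      ({s(corner 0 i, corner 0 j), s(corner 0 i, corner 0 k)} : Finset _).filter (· ∈ S) := by
    ext e
    simp only [Finset.mem_filter, Finset.mem_insert, Finset.mem_singleton]
    constructor
    · rintro ⟨he, hi⟩
      refine ⟨?_, he⟩
      obtain ⟨c, d, hcd, rfl⟩ := mem_E_zero.1 (mem_EF.1 (hS he))
      simp only [Sym2.mem_iff, inj] at hi
      simp only [Sym2.eq_iff, inj]
      omega
    · rintro ⟨rfl | rfl, he⟩ <;> exact ⟨he, by simp⟩
  have hne : s(corner 0 i, corner 0 j) ≠ s(corner 0 i, corner 0 k) := by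
    simp [inj, hjk, hik]
  rw [deg, h, Finset.card_filter, Finset.sum_pair hne]

lemma card_typedConf_zero_le (x y z : ℕ) : (typedConf 0 x y z).card ≤ 1 := by
  refine Finset.card_le_one.2 fun S hS T hT => ?_
  obtain ⟨hS, hx, hy, hz⟩ := Finset.mem_filter.1 hS
  obtain ⟨hT, hx', hy', hz'⟩ := Finset.mem_filter.1 hT
  have hS := (mem_conf.1 hS).1
  have hT := (mem_conf.1 hT).1
  have e10 := Sym2.eq_swap (a := corner 0 1) (b := corner 0 0)
  have e20 := Sym2.eq_swap (a := corner 0 2) (b := corner 0 0)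
  have e21 := Sym2.eq_swap (a := corner 0 2) (b := corner 0 1)
  rw [deg_corner_zero (j := 1) (k := 2) ‹_› (by decide) (by decide) (by decide)] at hx hx'
  rw [deg_corner_zero (j := 0) (k := 2) ‹_› (by decide) (by decide) (by decide), e10] at hy hy'
  rw [deg_corner_zero (j := 0) (k := 1) ‹_› (by decide) (by decide) (by decide), e20, e21] at hz hz'
  have key : (s(corner 0 0, corner 0 1) ∈ S ↔ s(corner 0 0, corner 0 1) ∈ T) ∧
      (s(corner 0 0, corner 0 2) ∈ S ↔ s(corner 0 0, corner 0 2) ∈ T) ∧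
      (s(corner 0 1, corner 0 2) ∈ S ↔ s(corner 0 1, corner 0 2) ∈ T) := by
    subst hx hy hz
    split_ifs at hx' hy' hz' <;> first
      | (exfalso; omega)
      | (simp only [*]; done)
      | simp [*]
  have hE : ∀ e ∈ E 0, e = s(corner 0 0, corner 0 1) ∨ e = s(corner 0 0, corner 0 2) ∨
      e = s(corner 0 1, corner 0 2) := fun e he => he
  ext e
  constructor <;> intro he
  · rcases hE e (mem_EF.1 (hS he)) with rfl | rfl | rfl <;> tauto
  · rcases hE e (mem_EF.1 (hT he)) with rfl | rfl | rfl <;> tauto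

lemma card_typedConf_le (n x y z : ℕ) : (typedConf n x y z).card ≤ typeBound n x y z := by
  induction n generalizing x y z with
  | zero =>
    rcases (typedConf 0 x y z).eq_empty_or_nonempty with h | ⟨S, hS⟩
    · simp [h]
    obtain ⟨hS, hx, hy, hz⟩ := Finset.mem_filter.1 hS
    refine (card_typedConf_zero_le x y z).trans ?_
    have h := corner_deg_cases hS hx hy hz
    simp only [List.mem_cons, Prod.mk.injEq, List.not_mem_nil, or_false] at h
    rcases h with (⟨rfl, rfl, rfl⟩ | ⟨rfl, rfl, rfl⟩ | ⟨rfl, rfl, rfl⟩ | ⟨rfl, rfl, rfl⟩ |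
      ⟨rfl, rfl, rfl⟩ | ⟨rfl, rfl, rfl⟩) | ⟨⟨rfl, rfl, rfl⟩, -⟩ <;> simp [typeBound, pathCount]
  | succ n ih =>
    rcases (typedConf (n + 1) x y z).eq_empty_or_nonempty with h | ⟨S, hS⟩
    · simp [h]
    obtain ⟨hS, hx, hy, hz⟩ := Finset.mem_filter.1 hS
    refine (card_typedConf_succ_le n x y z).trans ((Finset.sum_le_sum fun t _ =>
      Nat.mul_le_mul (Nat.mul_le_mul (ih x t.1 t.2.1) (ih (2 - t.1) y t.2.2))
        (ih (2 - t.2.1) (2 - t.2.2) z)).trans ?_)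
    simp only [Finset.sum_product, Finset.sum_range_succ, Finset.sum_range_zero]
    have h := corner_deg_cases hS hx hy hz
    have h0 : n = 0 → (pathCount n).1 = 1 := by rintro rfl; rfl
    simp only [List.mem_cons, Prod.mk.injEq, List.not_mem_nil, or_false] at h
    rcases h with (⟨rfl, rfl, rfl⟩ | ⟨rfl, rfl, rfl⟩ | ⟨rfl, rfl, rfl⟩ | ⟨rfl, rfl, rfl⟩ |
      ⟨rfl, rfl, rfl⟩ | ⟨rfl, rfl, rfl⟩) | ⟨-, h⟩
    · simp [typeBound, pathCount]; ring_nf; rfl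
    · simp [typeBound, pathCount]; ring_nf; rfl
    · simp [typeBound, pathCount]; ring_nf; rfl
    · by_cases hn : n = 0
      · simp [typeBound, pathCount, hn]
      · simp [typeBound, pathCount, hn]; ring_nf; rfl
    · by_cases hn : n = 0
      · simp [typeBound, pathCount, hn]
      · simp [typeBound, pathCount, hn]; ring_nf; rfl
    · by_cases hn : n = 0
      · simp [typeBound, pathCount, hn]
      · simp [typeBound, pathCount, hn]; ring_nf; rfl
    · omega

lemma pathCount_succ_fst (n : ℕ) :
    (pathCount (n + 1)).1 = 2 * (pathCount n).1 ^ 2 * (pathCount n).2 := rfl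

lemma pathCount_succ_snd (n : ℕ) : (pathCount (n + 1)).2 =
    2 * (pathCount n).1 * (pathCount n).2 ^ 2 + if n = 0 then 1 else 0 := rfl

lemma two_mul_pathCount_snd (n : ℕ) :
    2 * (pathCount (n + 1)).2 = 3 * (pathCount (n + 1)).1 := by
  induction n with
  | zero => rfl
  | succ n ih =>
    rw [pathCount_succ_fst, pathCount_succ_snd, if_neg n.succ_ne_zero, add_zero]
    linear_combination 2 * (pathCount (n + 1)).1 * (pathCount (n + 1)).2 * ih

lemma two_mul_pathCount_snd_le (n : ℕ) : 2 * (pathCount n).2 ≤ 3 * (pathCount n).1 := by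
  cases n with
  | zero => decide
  | succ n => exact (two_mul_pathCount_snd n).le

lemma pathCount_fst_le_snd (n : ℕ) : (pathCount n).1 ≤ (pathCount n).2 := by
  cases n with
  | zero => exact le_rfl
  | succ n =>
    have h := two_mul_pathCount_snd n
    omega

lemma pathCount_succ_succ_fst (n : ℕ) :
    (pathCount (n + 2)).1 = 3 * (pathCount (n + 1)).1 ^ 3 := by
  rw [pathCount_succ_fst]
  linear_combination (pathCount (n + 1)).1 ^ 2 * two_mul_pathCount_snd n

lemma three_mul_pathCount_sq (n : ℕ) : 3 * (pathCount (n + 1)).1 ^ 2 = 12 ^ 3 ^ n := by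
  induction n with
  | zero => rfl
  | succ n ih =>
    rw [pathCount_succ_succ_fst, pow_succ 3 n, pow_mul, ← ih]
    ring

lemma pathCount_fst_pos (n : ℕ) : 0 < (pathCount n).1 := by
  cases n with
  | zero => exact Nat.one_pos
  | succ n =>
    refine Nat.pos_of_ne_zero fun h => ?_
    have h' := three_mul_pathCount_sq n
    rw [h] at h'
    exact pow_ne_zero _ (by norm_num : (12 : ℕ) ≠ 0) h'.symm

lemma two_mul_pathCount_cube_le (n : ℕ) : 2 * (pathCount n).1 ^ 3 ≤ (pathCount (n + 1)).1 := by
  rw [pathCount_succ_fst]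
  calc 2 * (pathCount n).1 ^ 3 = 2 * (pathCount n).1 ^ 2 * (pathCount n).1 := by ring
    _ ≤ _ := Nat.mul_le_mul_left _ (pathCount_fst_le_snd n)

lemma card_conf_zero_le (n : ℕ) : (conf n 0).card ≤ 8 * (pathCount n).1 := by
  have h : conf n 0 ⊆ (Finset.range 3 ×ˢ Finset.range 3 ×ˢ Finset.range 3).biUnion
      fun t => typedConf n t.1 t.2.1 t.2.2 := fun S hS => by
    have h2 := (mem_conf.1 hS).2.2.1
    refine Finset.mem_biUnion.2 ⟨(deg S (corner n 0), deg S (corner n 1), deg S (corner n 2)), ?_,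
      Finset.mem_filter.2 ⟨hS, rfl, rfl, rfl⟩⟩
    simp only [Finset.mem_product, Finset.mem_range]
    exact ⟨Nat.lt_succ_of_le (h2 _), Nat.lt_succ_of_le (h2 _), Nat.lt_succ_of_le (h2 _)⟩
  refine (Finset.card_le_card h).trans (Finset.card_biUnion_le.trans
    ((Finset.sum_le_sum fun t _ => card_typedConf_le n t.1 t.2.1 t.2.2).trans ?_))
  simp only [Finset.sum_product, Finset.sum_range_succ, Finset.sum_range_zero, typeBound]
  have h1 := two_mul_pathCount_snd_le n
  have h2 := pathCount_fst_pos n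
  split_ifs <;> omega

lemma card_conf_level_zero_le (D : ℕ) : (conf 0 D).card ≤ 8 := by
  refine (Finset.card_le_card (Finset.filter_subset _ _)).trans ?_
  rw [Finset.card_powerset]
  have h : (EF 0).card ≤ 3 := by
    refine (Finset.card_le_card (t := {s(o, a 0), s(o, b 0), s(a 0, b 0)}) fun e he => ?_).trans
      Finset.card_le_three
    have h : e ∈ E 0 := mem_EF.1 he
    simpa [E] using h
  exact Nat.pow_le_pow_right two_pos h

lemma le_vec_iff {k : Fin 3 → ℕ} {x y z : ℕ} : k ≤ ![x, y, z] ↔ k 0 ≤ x ∧ k 1 ≤ y ∧ k 2 ≤ z :=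
  ⟨fun h => ⟨h 0, h 1, h 2⟩, fun h c => by
    fin_cases c
    exacts [h.1, h.2.1, h.2.2]⟩

lemma card_conf_one_le (n : ℕ) : (conf n 1).card ≤ 8 * 96 ^ n * (pathCount n).1 := by
  induction n with
  | zero => exact card_conf_level_zero_le 1
  | succ n ih =>
    refine (card_conf_succ_le n 1 {![1, 0, 0], ![0, 1, 0], ![0, 0, 1]} fun k hk => ?_).trans ?_
    · rw [Fin.sum_univ_three] at hk
      simp only [Finset.mem_insert, Finset.mem_singleton, exists_eq_or_imp, exists_eq_left,
        le_vec_iff]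
      omega
    · rw [Finset.sum_insert (by decide), Finset.sum_insert (by decide), Finset.sum_singleton]
      simp only [Fin.prod_univ_three]
      change (conf n 1).card * (conf n 0).card * (conf n 0).card +
        ((conf n 0).card * (conf n 1).card * (conf n 0).card +
          (conf n 0).card * (conf n 0).card * (conf n 1).card) ≤ _
      have h0 := card_conf_zero_le n
      calc _ = 3 * ((conf n 1).card * (conf n 0).card * (conf n 0).card) := by ring
        _ ≤ 3 * ((8 * 96 ^ n * (pathCount n).1) * (8 * (pathCount n).1) *
            (8 * (pathCount n).1)) := by gcongr
        _ = 8 * 96 ^ (n + 1) * (2 * (pathCount n).1 ^ 3) := by ring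
        _ ≤ _ := Nat.mul_le_mul_left _ (two_mul_pathCount_cube_le n)

lemma card_conf_two_le (n : ℕ) : (conf n 2).card ≤ 8 * 9216 ^ n * (pathCount n).1 := by
  induction n with
  | zero => exact card_conf_level_zero_le 2
  | succ n ih =>
    refine (card_conf_succ_le n 2 {![2, 0, 0], ![0, 2, 0], ![0, 0, 2], ![1, 1, 0], ![1, 0, 1],
      ![0, 1, 1]} fun k hk => ?_).trans ?_
    · rw [Fin.sum_univ_three] at hk
      simp only [Finset.mem_insert, Finset.mem_singleton, exists_eq_or_imp, exists_eq_left,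
        le_vec_iff]
      omega
    · rw [Finset.sum_insert (by decide), Finset.sum_insert (by decide),
        Finset.sum_insert (by decide), Finset.sum_insert (by decide),
        Finset.sum_insert (by decide), Finset.sum_singleton]
      simp only [Fin.prod_univ_three]
      change (conf n 2).card * (conf n 0).card * (conf n 0).card +
        ((conf n 0).card * (conf n 2).card * (conf n 0).card +
        ((conf n 0).card * (conf n 0).card * (conf n 2).card +
        ((conf n 1).card * (conf n 1).card * (conf n 0).card +
        ((conf n 1).card * (conf n 0).card * (conf n 1).card +
          (conf n 0).card * (conf n 1).card * (conf n 1).card)))) ≤ _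
      have h0 := card_conf_zero_le n
      have h1 := card_conf_one_le n
      calc _ = 3 * ((conf n 2).card * (conf n 0).card * (conf n 0).card +
            (conf n 1).card * (conf n 1).card * (conf n 0).card) := by ring
        _ ≤ 3 * ((8 * 9216 ^ n * (pathCount n).1) * (8 * (pathCount n).1) *
              (8 * (pathCount n).1) + (8 * 96 ^ n * (pathCount n).1) *
              (8 * 96 ^ n * (pathCount n).1) * (8 * (pathCount n).1)) := by gcongr
        _ = 8 * (192 * 9216 ^ n) * (2 * (pathCount n).1 ^ 3) := by
          rw [show (9216 : ℕ) = 96 * 96 by norm_num, mul_pow]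
          ring
        _ ≤ 8 * (9216 * 9216 ^ n) * (2 * (pathCount n).1 ^ 3) := by gcongr; norm_num
        _ ≤ _ := by
          rw [pow_succ' 9216]
          exact Nat.mul_le_mul_left _ (two_mul_pathCount_cube_le n)

/-- The set of edges between consecutive vertices of a list. -/
def edgesOf : List (ℝ × ℝ) → Finset (Sym2 (ℝ × ℝ))
  | [] => ∅
  | [_] => ∅
  | x :: y :: l => insert s(x, y) (edgesOf (y :: l))

lemma edgesOf_cons_cons (x y : ℝ × ℝ) (l : List (ℝ × ℝ)) :
    edgesOf (x :: y :: l) = insert s(x, y) (edgesOf (y :: l)) := rfl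

lemma mem_of_mem_edgesOf {l : List (ℝ × ℝ)} {e : Sym2 (ℝ × ℝ)} {v : ℝ × ℝ}
    (he : e ∈ edgesOf l) (hv : v ∈ e) : v ∈ l := by
  induction l with
  | nil => simp [edgesOf] at he
  | cons x l ih =>
    cases l with
    | nil => simp [edgesOf] at he
    | cons y l =>
      rcases Finset.mem_insert.1 he with rfl | he
      · rcases Sym2.mem_iff.1 hv with rfl | rfl <;> simp
      · exact List.mem_cons_of_mem _ (ih he)

lemma deg_edgesOf_eq_zero {l : List (ℝ × ℝ)} {v : ℝ × ℝ} (hv : v ∉ l) : deg (edgesOf l) v = 0 := by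
  refine Finset.card_eq_zero.2 (Finset.filter_eq_empty_iff.2 fun e he h => hv ?_)
  exact mem_of_mem_edgesOf he h

lemma deg_edgesOf_cons_cons {x y : ℝ × ℝ} {l : List (ℝ × ℝ)} (h : (x :: y :: l).Nodup)
    (v : ℝ × ℝ) : deg (edgesOf (x :: y :: l)) v =
      deg (edgesOf (y :: l)) v + if v = x ∨ v = y then 1 else 0 := by
  have hx : s(x, y) ∉ edgesOf (y :: l) := fun hx =>
    (List.nodup_cons.1 h).1 (mem_of_mem_edgesOf hx (Sym2.mem_mk_left x y))
  rw [edgesOf_cons_cons, deg, Finset.filter_insert]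
  simp only [Sym2.mem_iff]
  split_ifs
  · rw [Finset.card_insert_of_notMem fun h => hx (Finset.mem_filter.1 h).1, deg]
  · rw [deg, add_zero]

lemma deg_edgesOf_head {x y : ℝ × ℝ} {l : List (ℝ × ℝ)} (h : (x :: y :: l).Nodup) :
    deg (edgesOf (x :: y :: l)) x = 1 := by
  rw [deg_edgesOf_cons_cons h, deg_edgesOf_eq_zero (List.nodup_cons.1 h).1, if_pos (Or.inl rfl)]

lemma deg_edgesOf_head_le {x : ℝ × ℝ} {l : List (ℝ × ℝ)} (h : (x :: l).Nodup) :
    deg (edgesOf (x :: l)) x ≤ 1 := by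
  cases l with
  | nil => simp [edgesOf, deg]
  | cons y l => exact (deg_edgesOf_head h).le

lemma deg_edgesOf_le_two {l : List (ℝ × ℝ)} (h : l.Nodup) (v : ℝ × ℝ) :
    deg (edgesOf l) v ≤ 2 := by
  induction l with
  | nil => simp [edgesOf, deg]
  | cons x l ih =>
    cases l with
    | nil => simp [edgesOf, deg]
    | cons y l =>
      have h' := (List.nodup_cons.1 h).2
      rw [deg_edgesOf_cons_cons h]
      split_ifs with hv
      · rcases hv with rfl | rfl
        · rw [deg_edgesOf_eq_zero (List.nodup_cons.1 h).1]
          norm_num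
        · have := deg_edgesOf_head_le h'
          omega
      · exact ih h'

lemma deg_edgesOf_eq_two {x v : ℝ × ℝ} {l : List (ℝ × ℝ)} (h : (x :: l).Nodup) (hv : v ∈ l)
    (hlast : v ≠ (x :: l).getLast (List.cons_ne_nil x l)) : deg (edgesOf (x :: l)) v = 2 := by
  induction l generalizing x with
  | nil => simp at hv
  | cons y l ih =>
    have h' := (List.nodup_cons.1 h).2
    have hvx : v ≠ x := by
      rintro rfl
      exact (List.nodup_cons.1 h).1 hv
    rw [List.getLast_cons (List.cons_ne_nil y l)] at hlast
    rw [deg_edgesOf_cons_cons h]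
    rcases List.mem_cons.1 hv with rfl | hvl
    · rw [if_pos (Or.inr rfl)]
      cases l with
      | nil => exact absurd rfl hlast
      | cons z l => rw [deg_edgesOf_head h']
    · have hvy : v ≠ y := by
        rintro rfl
        exact (List.nodup_cons.1 h').1 hvl
      rw [ih h' hvl hlast, if_neg (by tauto)]

lemma isForest_edgesOf {l : List (ℝ × ℝ)} (h : l.Nodup) : IsForest (edgesOf l) := by
  induction l with
  | nil =>
    rintro T hT ⟨e, he⟩
    simpa [edgesOf] using hT he
  | cons x l ih =>
    cases l with
    | nil =>
      rintro T hT ⟨e, he⟩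
      simpa [edgesOf] using hT he
    | cons y l =>
      intro T hT hT'
      by_cases hxy : s(x, y) ∈ T
      · refine ⟨x, le_antisymm ((deg_mono hT x).trans_eq (deg_edgesOf_head h)) ?_⟩
        exact Finset.card_pos.2 ⟨_, Finset.mem_filter.2 ⟨hxy, Sym2.mem_mk_left x y⟩⟩
      · exact ih (List.nodup_cons.1 h).2 T ((Finset.subset_insert_iff_of_notMem hxy).1 hT) hT'

lemma eq_of_edgesOf_eq {x : ℝ × ℝ} {l l' : List (ℝ × ℝ)} (h : (x :: l).Nodup)
    (h' : (x :: l').Nodup) (he : edgesOf (x :: l) = edgesOf (x :: l')) : l = l' := by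
  induction l generalizing x l' with
  | nil =>
    cases l' with
    | nil => rfl
    | cons y l' => exact absurd he.symm (Finset.insert_ne_empty _ _)
  | cons y l ih =>
    cases l' with
    | nil => exact absurd he (Finset.insert_ne_empty _ _)
    | cons z l' =>
      have hx : ∀ {y l e}, (x :: y :: l).Nodup → x ∈ e → e ∉ edgesOf (y :: l) :=
        fun h hx he => (List.nodup_cons.1 h).1 (mem_of_mem_edgesOf he hx)
      have hyz : s(x, y) ∈ edgesOf (x :: z :: l') := he ▸ Finset.mem_insert_self _ _
      obtain rfl : y = z := by
        rcases Finset.mem_insert.1 hyz with hyz | hyz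
        · exact Sym2.congr_right.1 hyz
        · exact absurd hyz (hx h' (Sym2.mem_mk_left x y))
      rw [ih (List.nodup_cons.1 h).2 (List.nodup_cons.1 h').2]
      rw [edgesOf_cons_cons, edgesOf_cons_cons] at he
      rw [← Finset.erase_insert (hx h (Sym2.mem_mk_left x y)), he,
        Finset.erase_insert (hx h' (Sym2.mem_mk_left x y))]

/-- `IsHamList n l` means that `l` lists the vertices of a Hamiltonian path of `SG n`. -/
structure IsHamList (n : ℕ) (l : List (ℝ × ℝ)) : Prop where
  isChain : l.IsChain fun x y => s(x, y) ∈ E n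
  nodup : l.Nodup
  mem_iff : ∀ v, v ∈ l ↔ v ∈ V n

lemma IsHamList.ne_nil {n : ℕ} {l : List (ℝ × ℝ)} (h : IsHamList n l) : l ≠ [] :=
  List.ne_nil_of_mem ((h.mem_iff _).2 (corner_mem_V n 0))

lemma edgesOf_subset {n : ℕ} {l : List (ℝ × ℝ)} (h : l.IsChain fun x y => s(x, y) ∈ E n) :
    edgesOf l ⊆ EF n := by
  induction l with
  | nil => simp [edgesOf]
  | cons x l ih =>
    cases l with
    | nil => simp [edgesOf]
    | cons y l =>
      rw [List.isChain_cons_cons] at h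
      exact Finset.insert_subset (mem_EF.2 h.1) (ih h.2)

lemma IsHamList.edgesOf_mem_conf {n : ℕ} {l : List (ℝ × ℝ)} (h : IsHamList n l) :
    edgesOf l ∈ conf n 2 := by
  refine mem_conf.2 ⟨edgesOf_subset h.isChain, isForest_edgesOf h.nodup,
    deg_edgesOf_le_two h.nodup, ?_⟩
  obtain ⟨x, l, rfl⟩ := List.exists_cons_of_ne_nil h.ne_nil
  refine (Finset.card_le_card (t := {x, (x :: l).getLast (List.cons_ne_nil x l)})
    fun v hv => ?_).trans Finset.card_le_two
  obtain ⟨hv, -, hv2⟩ := mem_defects.1 hv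
  by_contra hcon
  simp only [Finset.mem_insert, Finset.mem_singleton, not_or] at hcon
  exact hv2 (deg_edgesOf_eq_two h.nodup
    ((List.mem_cons.1 ((h.mem_iff v).2 hv)).resolve_left hcon.1) hcon.2)

lemma IsHamList.mapsTo (n : ℕ) : Set.MapsTo (fun l => (l.headD 0, edgesOf l))
    {l | IsHamList n l} (VF n ×ˢ conf n 2 : Finset _) := fun l hl => by
  refine Finset.mem_product.2 ⟨mem_VF.2 ((hl.mem_iff _).1 ?_), hl.edgesOf_mem_conf⟩
  obtain ⟨x, l, rfl⟩ := List.exists_cons_of_ne_nil hl.ne_nil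
  exact List.mem_cons_self

lemma IsHamList.injOn (n : ℕ) : Set.InjOn (fun l => (l.headD 0, edgesOf l))
    {l | IsHamList n l} := fun l hl l' hl' h => by
  obtain ⟨x, l, rfl⟩ := List.exists_cons_of_ne_nil hl.ne_nil
  obtain ⟨x', l', rfl⟩ := List.exists_cons_of_ne_nil hl'.ne_nil
  obtain ⟨rfl, h⟩ : x = x' ∧ edgesOf (x :: l) = edgesOf (x' :: l') := Prod.mk.inj h
  rw [eq_of_edgesOf_eq hl.nodup hl'.nodup h]

lemma finite_isHamList (n : ℕ) : {l | IsHamList n l}.Finite :=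
  Set.Finite.of_injOn (IsHamList.mapsTo n) (IsHamList.injOn n) (Finset.finite_toSet _)

/-- The vertex lists of Hamiltonian paths of `SG n`. -/
def hamLists (n : ℕ) : Finset (List (ℝ × ℝ)) := (finite_isHamList n).toFinset

lemma mem_hamLists {n : ℕ} {l : List (ℝ × ℝ)} : l ∈ hamLists n ↔ IsHamList n l := by
  simp [hamLists]

lemma card_VF_le (n : ℕ) : (VF n).card ≤ 3 ^ (n + 1) := by
  induction n with
  | zero =>
    refine (Finset.card_le_card (t := Finset.univ.image (corner 0)) fun x hx => ?_).trans
      Finset.card_image_le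
    obtain ⟨c, rfl⟩ := mem_V_zero.1 (mem_VF.1 hx)
    exact Finset.mem_image_of_mem _ (Finset.mem_univ c)
  | succ n ih =>
    calc (VF (n + 1)).card
        ≤ (Finset.univ.biUnion fun c => (VF n).image (· + corner n c)).card := by
          refine Finset.card_le_card fun x hx => ?_
          obtain ⟨c, y, hy, rfl⟩ := mem_V_succ.1 (mem_VF.1 hx)
          exact Finset.mem_biUnion.2 ⟨c, Finset.mem_univ c,
            Finset.mem_image_of_mem _ (mem_VF.2 hy)⟩
      _ ≤ Fintype.card (Fin 3) * 3 ^ (n + 1) :=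
          Finset.card_biUnion_le_card_mul _ _ _ fun c _ => Finset.card_image_le.trans ih
      _ = 3 ^ (n + 1 + 1) := by rw [Fintype.card_fin, pow_succ' 3 (n + 1)]

lemma card_hamLists_le (n : ℕ) :
    (hamLists n).card ≤ 3 ^ (n + 1) * (8 * 9216 ^ n * (pathCount n).1) :=
  calc (hamLists n).card ≤ (VF n ×ˢ conf n 2).card :=
        Finset.card_le_card_of_injOn _ (fun _ hl => IsHamList.mapsTo n (mem_hamLists.1 hl))
          fun _ hl _ hl' => IsHamList.injOn n (mem_hamLists.1 hl) (mem_hamLists.1 hl')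
    _ = (VF n).card * (conf n 2).card := Finset.card_product _ _
    _ ≤ _ := Nat.mul_le_mul (card_VF_le n) (card_conf_two_le n)

lemma adj_iff {n : ℕ} {x y : ℝ × ℝ} : (G n).Adj x y ↔ s(x, y) ∈ E n := by
  rw [G, SimpleGraph.fromEdgeSet_adj]
  exact and_iff_left_of_imp fun h => (ne_and_mem_of_mem_E h).1

lemma adj_eq (n : ℕ) : (G n).Adj = fun x y => s(x, y) ∈ E n := by
  ext x y
  exact adj_iff

lemma IsHamPath.isHamList {n : ℕ} {u v : ℝ × ℝ} {p : (G n).Walk u v} (hp : IsHamPath n p) :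
    IsHamList n p.support :=
  ⟨adj_eq n ▸ p.isChain_adj_support, hp.1.support_nodup, hp.2⟩

lemma f_eq_card (n : ℕ) (u v : ℝ × ℝ) :
    f n u v = ((hamLists n).filter fun l => l.headD 0 = u ∧ l.getLastD 0 = v).card := by
  rw [f, ← Nat.card_eq_finsetCard]
  refine Nat.card_eq_of_bijective (fun p => ⟨p.1.support, Finset.mem_filter.2
    ⟨mem_hamLists.2 p.2.isHamList, ?_, ?_⟩⟩) ⟨fun p q h => ?_, ?_⟩
  · rw [List.headD_eq_head?_getD, List.head?_eq_some_head p.1.support_ne_nil]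
    exact p.1.head_support
  · rw [List.getLastD_eq_getLast?, List.getLast?_eq_some_getLast p.1.support_ne_nil]
    exact p.1.getLast_support
  · exact Subtype.ext (SimpleGraph.Walk.ext_support (Subtype.ext_iff.1 h))
  · rintro ⟨l, hlf⟩
    obtain ⟨hlm, hu, hv⟩ := Finset.mem_filter.1 hlf
    have hl := mem_hamLists.1 hlm
    rw [List.headD_eq_head?_getD, List.head?_eq_some_head hl.ne_nil] at hu
    rw [List.getLastD_eq_getLast?, List.getLast?_eq_some_getLast hl.ne_nil] at hv
    have hchain : l.IsChain (G n).Adj := (adj_eq n).symm ▸ hl.isChain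
    have hs := SimpleGraph.Walk.support_ofSupport hl.ne_nil hchain
    obtain rfl : l.head hl.ne_nil = u := hu
    obtain rfl : l.getLast hl.ne_nil = v := hv
    refine ⟨⟨SimpleGraph.Walk.ofSupport l hl.ne_nil hchain, ⟨?_, ?_⟩⟩, Subtype.ext hs⟩
    · rw [SimpleGraph.Walk.isPath_def, hs]
      exact hl.nodup
    · rw [hs]
      exact hl.mem_iff

lemma IsHamList.headD_mem {n : ℕ} {l : List (ℝ × ℝ)} (h : IsHamList n l) : l.headD 0 ∈ VF n := by
  rw [List.headD_eq_head?_getD, List.head?_eq_some_head h.ne_nil]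
  exact mem_VF.2 ((h.mem_iff _).1 (List.head_mem h.ne_nil))

lemma IsHamList.getLastD_mem {n : ℕ} {l : List (ℝ × ℝ)} (h : IsHamList n l) :
    l.getLastD 0 ∈ VF n := by
  rw [List.getLastD_eq_getLast?, List.getLast?_eq_some_getLast h.ne_nil]
  exact mem_VF.2 ((h.mem_iff _).1 (List.getLast_mem h.ne_nil))

lemma mem_VF_of_f_ne_zero {n : ℕ} {u v : ℝ × ℝ} (h : f n u v ≠ 0) : u ∈ VF n ∧ v ∈ VF n := by
  rw [f_eq_card] at h
  obtain ⟨l, hlf⟩ := Finset.card_ne_zero.1 h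
  obtain ⟨hl, rfl, rfl⟩ := Finset.mem_filter.1 hlf
  exact ⟨(mem_hamLists.1 hl).headD_mem, (mem_hamLists.1 hl).getLastD_mem⟩

lemma H_eq (n : ℕ) : H n = (hamLists n).card / 2 := by
  have h1 : ∀ u, ∑ᶠ v, f n u v = ∑ v ∈ VF n, f n u v := fun u =>
    finsum_eq_sum_of_support_subset _ fun v hv => (mem_VF_of_f_ne_zero hv).2
  have h2 : ∑ᶠ u, ∑ᶠ v, f n u v = ∑ u ∈ VF n, ∑ v ∈ VF n, f n u v := by
    simp only [h1]
    refine finsum_eq_sum_of_support_subset _ fun u hu => ?_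
    obtain ⟨v, -, hv⟩ := Finset.exists_ne_zero_of_sum_ne_zero hu
    exact (mem_VF_of_f_ne_zero hv).1
  rw [H, h2, Finset.card_eq_sum_card_fiberwise (f := fun l => (l.headD 0, l.getLastD 0))
    (t := VF n ×ˢ VF n) fun l hl => ?_, Finset.sum_product]
  · simp only [f_eq_card, Prod.mk.injEq]
  · exact Finset.mem_product.2 ⟨(mem_hamLists.1 hl).headD_mem, (mem_hamLists.1 hl).getLastD_mem⟩

/-- `PathOn n s x Z l` means that `l` lists the vertices of a path of `SG n` which starts at `x`,
ends in `Z` and has vertex set `s`. -/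
structure PathOn (n : ℕ) (s : Set (ℝ × ℝ)) (x : ℝ × ℝ) (Z : Set (ℝ × ℝ)) (l : List (ℝ × ℝ)) :
    Prop where
  isChain : l.IsChain fun x y => s(x, y) ∈ E n
  nodup : l.Nodup
  head : l.head? = some x
  last : ∃ z ∈ Z, l.getLast? = some z
  mem_iff : ∀ v, v ∈ l ↔ v ∈ s

/-- The paths of `SG n` obtained by joining at `y` a path from `x` to `y` with vertex set `s` and a
path from `y` to `Z` with vertex set `t`. -/
def joins (n : ℕ) (s t : Set (ℝ × ℝ)) (x y : ℝ × ℝ) (Z : Set (ℝ × ℝ)) : Set (List (ℝ × ℝ)) :=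
  (fun p => p.1 ++ p.2.tail) '' ({l | PathOn n s x {y} l} ×ˢ {l | PathOn n t y Z l})

section Joins

variable {n : ℕ} {s t : Set (ℝ × ℝ)} {x y : ℝ × ℝ} {Z : Set (ℝ × ℝ)} {l m : List (ℝ × ℝ)}

lemma PathOn.exists_eq_concat (h : PathOn n s x {y} l) : ∃ k, l = k ++ [y] := by
  obtain ⟨z, rfl, hz⟩ := h.last
  exact List.getLast?_eq_some_iff.1 hz

lemma PathOn.exists_eq_cons (h : PathOn n s x Z l) : ∃ k, l = x :: k :=
  List.head?_eq_some_iff.1 h.head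

lemma PathOn.mono (h : PathOn n s x Z l) {Z' : Set (ℝ × ℝ)} (hZ : Z ∩ s ⊆ Z') :
    PathOn n s x Z' l := by
  obtain ⟨z, hz, hl⟩ := h.last
  exact ⟨h.isChain, h.nodup, h.head,
    ⟨z, hZ ⟨hz, (h.mem_iff z).1 (List.mem_of_getLast? hl)⟩, hl⟩, h.mem_iff⟩

lemma joins_subset (hst : s ∩ t ⊆ {y}) : joins n s t x y Z ⊆ {l | PathOn n (s ∪ t) x Z l} := by
  rintro _ ⟨⟨l, m⟩, ⟨hl, hm⟩, rfl⟩
  obtain ⟨k, rfl⟩ := PathOn.exists_eq_concat hl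
  obtain ⟨m, rfl⟩ := PathOn.exists_eq_cons hm
  have hl : PathOn n s x {y} (k ++ [y]) := hl
  have hm : PathOn n t y Z (y :: m) := hm
  have hy : ∀ z ∈ m, z ∉ k ++ [y] := fun z hzm hzk => by
    obtain rfl : z = y := hst ⟨(hl.mem_iff z).1 hzk,
      (hm.mem_iff z).1 (List.mem_cons_of_mem _ hzm)⟩
    exact (List.nodup_cons.1 hm.nodup).1 hzm
  obtain ⟨z, hz, hz'⟩ := hm.last
  refine ⟨?_, ?_, ?_, ⟨z, hz, ?_⟩, fun v => ?_⟩
  · refine List.isChain_append.2 ⟨hl.isChain, hm.isChain.tail, fun a ha b hb => ?_⟩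
    rw [List.getLast?_concat] at ha
    obtain rfl := Option.some.inj ha
    exact hm.isChain.rel_head? hb
  · exact List.nodup_append.2 ⟨hl.nodup, (List.nodup_cons.1 hm.nodup).2,
      fun a ha b hb hab => hy b hb (hab ▸ ha)⟩
  · have := hl.head
    simp_all
  · simp_all
  · have h1 := hl.mem_iff v
    have h2 := hm.mem_iff v
    have h3 := (hl.mem_iff y).1 (by simp)
    have h4 := (hm.mem_iff y).1 (by simp)
    simp only [List.tail_cons, List.mem_append, Set.mem_union, ← h1, ← h2, List.mem_cons]
    simp
    tauto

lemma eq_of_append_tail_eq {s' t' : Set (ℝ × ℝ)} {l' m' : List (ℝ × ℝ)}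
    (hl : PathOn n s x {y} l) (hm : PathOn n t y Z m)
    (hl' : PathOn n s' x {y} l') (hm' : PathOn n t' y Z m')
    (h : l ++ m.tail = l' ++ m'.tail) : l = l' ∧ m = m' := by
  obtain ⟨k, rfl⟩ := hl.exists_eq_concat
  obtain ⟨m, rfl⟩ := hm.exists_eq_cons
  obtain ⟨k', rfl⟩ := hl'.exists_eq_concat
  obtain ⟨m', rfl⟩ := hm'.exists_eq_cons
  have hy : y ∉ k := fun hy => (List.nodup_append.1 hl.nodup).2.2 y hy y
    (List.mem_singleton_self y) rfl
  rw [List.append_assoc, List.append_assoc] at h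
  obtain ⟨rfl, -, rfl⟩ := (List.append_cons_inj_of_notMem hy (List.nodup_cons.1 hm.nodup).1).1 h
  exact ⟨rfl, rfl⟩

lemma le_encard_joins {N M : ℕ∞} (hN : N ≤ {l | PathOn n s x {y} l}.encard)
    (hM : M ≤ {l | PathOn n t y Z l}.encard) : N * M ≤ (joins n s t x y Z).encard := by
  rw [joins, Set.InjOn.encard_image, Set.encard_prod]
  · gcongr
  · rintro ⟨l, m⟩ ⟨hl, hm⟩ ⟨l', m'⟩ ⟨hl', hm'⟩ h
    obtain ⟨rfl, rfl⟩ := eq_of_append_tail_eq hl hm hl' hm' h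
    rfl

lemma disjoint_joins {s' t' : Set (ℝ × ℝ)} (hs : s ≠ s') :
    Disjoint (joins n s t x y Z) (joins n s' t' x y Z) := by
  rw [Set.disjoint_left]
  rintro _ ⟨⟨l, m⟩, ⟨hl, hm⟩, rfl⟩ ⟨⟨l', m'⟩, ⟨hl', hm'⟩, h⟩
  obtain ⟨rfl, -⟩ := eq_of_append_tail_eq hl hm hl' hm' h.symm
  exact hs (Set.ext fun v => ((hl.mem_iff v).symm.trans (hl'.mem_iff v)))

lemma le_encard_pathOn_join {u : Set (ℝ × ℝ)} (hst : s ∩ t ⊆ {y}) (hu : s ∪ t = u) {N M : ℕ∞}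
    (hN : N ≤ {l | PathOn n s x {y} l}.encard) (hM : M ≤ {l | PathOn n t y Z l}.encard) :
    N * M ≤ {l | PathOn n u x Z l}.encard :=
  (le_encard_joins hN hM).trans (Set.encard_le_encard (hu ▸ joins_subset hst))

lemma le_encard_pathOn_join_add {u s' t' : Set (ℝ × ℝ)} (hst : s ∩ t ⊆ {y}) (hst' : s' ∩ t' ⊆ {y})
    (hs : s ≠ s') (hu : s ∪ t = u) (hu' : s' ∪ t' = u) {N M N' M' : ℕ∞}
    (hN : N ≤ {l | PathOn n s x {y} l}.encard) (hM : M ≤ {l | PathOn n t y Z l}.encard)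
    (hN' : N' ≤ {l | PathOn n s' x {y} l}.encard) (hM' : M' ≤ {l | PathOn n t' y Z l}.encard) :
    N * M + N' * M' ≤ {l | PathOn n u x Z l}.encard :=
  calc N * M + N' * M' ≤ (joins n s t x y Z).encard + (joins n s' t' x y Z).encard :=
        add_le_add (le_encard_joins hN hM) (le_encard_joins hN' hM')
    _ = (joins n s t x y Z ∪ joins n s' t' x y Z).encard :=
        (Set.encard_union_eq (disjoint_joins hs)).symm
    _ ≤ _ := Set.encard_le_encard (Set.union_subset (hu ▸ joins_subset hst)
        (hu' ▸ joins_subset hst'))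

lemma le_encard_pathOn_add {Z' Z'' : Set (ℝ × ℝ)} (hZ : Disjoint Z Z') (hZs : Z ∪ Z' ⊆ Z'')
    {N M : ℕ∞} (hN : N ≤ {l | PathOn n s x Z l}.encard) (hM : M ≤ {l | PathOn n s x Z' l}.encard) :
    N + M ≤ {l | PathOn n s x Z'' l}.encard := by
  refine (add_le_add hN hM).trans ?_
  rw [← Set.encard_union_eq]
  · refine Set.encard_le_encard ?_
    rintro l (hl | hl)
    · exact PathOn.mono hl fun z hz => hZs (Or.inl hz.1)
    · exact PathOn.mono hl fun z hz => hZs (Or.inr hz.1)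
  · rw [Set.disjoint_left]
    intro l hl hl'
    obtain ⟨z, hz, h⟩ := hl.last
    obtain ⟨z', hz', h'⟩ := hl'.last
    obtain rfl : z = z' := Option.some.inj (h.symm.trans h')
    exact Set.disjoint_left.1 hZ hz hz'

lemma le_encard_pathOn_shift (c : Fin 3) {N : ℕ∞} (hN : N ≤ {l | PathOn n s x Z l}.encard) :
    N ≤ {l | PathOn (n + 1) ((· + corner n c) '' s) (x + corner n c)
      ((· + corner n c) '' Z) l}.encard := by
  have hinj := add_left_injective (corner n c)
  rw [← (List.map_injective_iff.2 hinj).encard_image] at hN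
  refine hN.trans (Set.encard_le_encard ?_)
  rintro _ ⟨l, hl, rfl⟩
  obtain ⟨z, hz, hz'⟩ := hl.last
  refine ⟨?_, hl.nodup.map hinj, ?_, ⟨_, ⟨z, hz, rfl⟩, ?_⟩, fun v => ?_⟩
  · exact List.isChain_map_of_isChain _ (fun x y h => mem_E_succ.2 ⟨c, _, h, rfl⟩) hl.isChain
  · rw [List.head?_map, hl.head]; rfl
  · rw [List.getLast?_map, hz']; rfl
  · simp only [List.mem_map, Set.mem_image, hl.mem_iff]

end Joins

/-- The vertex set of the `c`-th copy of `SG n` inside `SG (n + 1)`. -/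
def copy (n : ℕ) (c : Fin 3) : Set (ℝ × ℝ) := (· + corner n c) '' V n

/-- For `c ≠ d`, the common vertex of the `c`-th and the `d`-th copy of `SG n` in `SG (n + 1)`;
for `c = d`, an outmost vertex of `SG (n + 1)`. -/
def junction (n : ℕ) (c d : Fin 3) : ℝ × ℝ := corner n c + corner n d

lemma junction_comm (n : ℕ) (c d : Fin 3) : junction n c d = junction n d c := add_comm _ _

lemma junction_self (n : ℕ) (c : Fin 3) : junction n c c = corner (n + 1) c :=
  (corner_succ n c).symm

lemma junction_mem_left (n : ℕ) (c d : Fin 3) : junction n c d ∈ copy n c :=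
  ⟨corner n d, corner_mem_V n d, add_comm _ _⟩

lemma junction_mem_right (n : ℕ) (c d : Fin 3) : junction n c d ∈ copy n d :=
  ⟨corner n c, corner_mem_V n c, rfl⟩

lemma junction_right_injective (n : ℕ) (c : Fin 3) : Function.Injective (junction n c) :=
  fun _ _ h => corner_injective n (add_left_cancel h)

lemma eq_junction {n : ℕ} {c d : Fin 3} (hcd : c ≠ d) {v : ℝ × ℝ} (hc : v ∈ copy n c)
    (hd : v ∈ copy n d) : v = junction n c d := by
  obtain ⟨x, hx, rfl⟩ := hc
  obtain ⟨y, hy, h⟩ := hd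
  rw [junction, (eq_corner_of_add_eq hcd hx hy h.symm).1, add_comm]

lemma junction_notMem {n : ℕ} {c d e : Fin 3} (hc : c ≠ e) (hd : d ≠ e) :
    junction n c d ∉ copy n e := fun h =>
  hd (junction_right_injective n c (eq_junction hc (junction_mem_left n c d) h))

lemma mem_V_succ_iff_copy {n : ℕ} {i j k : Fin 3} (hij : i ≠ j) (hik : i ≠ k) (hjk : j ≠ k)
    {v : ℝ × ℝ} : v ∈ V (n + 1) ↔ v ∈ copy n i ∨ v ∈ copy n j ∨ v ∈ copy n k := by
  rw [mem_V_succ]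
  constructor
  · rintro ⟨c, h⟩
    obtain rfl | rfl | rfl : c = i ∨ c = j ∨ c = k := by omega
    exacts [Or.inl h, Or.inr (Or.inl h), Or.inr (Or.inr h)]
  · rintro (h | h | h)
    exacts [⟨i, h⟩, ⟨j, h⟩, ⟨k, h⟩]

/-- There are `N` Hamiltonian paths of `SG n` between any two outmost vertices. -/
def FullBound (n N : ℕ) : Prop :=
  ∀ i j, i ≠ j → (N : ℕ∞) ≤ {l | PathOn n (V n) (corner n i) {corner n j} l}.encard

/-- There are `N` paths of `SG n` between any two outmost vertices omitting only the third one. -/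
def OmitBound (n N : ℕ) : Prop :=
  ∀ i j k, i ≠ j → i ≠ k → j ≠ k →
    (N : ℕ∞) ≤ {l | PathOn n (V n \ {corner n k}) (corner n i) {corner n j} l}.encard

/-- There are `N` Hamiltonian paths of `SG n` starting at any outmost vertex. -/
def StartBound (n N : ℕ) : Prop :=
  ∀ i, (N : ℕ∞) ≤ {l | PathOn n (V n) (corner n i) (V n \ {corner n i}) l}.encard

lemma FullBound.le_copy {n N : ℕ} (h : FullBound n N) (c : Fin 3) {i j : Fin 3} (hij : i ≠ j) :
    (N : ℕ∞) ≤
      {l | PathOn (n + 1) (copy n c) (junction n i c) {junction n j c} l}.encard := by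
  have := le_encard_pathOn_shift c (h i j hij)
  rwa [Set.image_singleton] at this

lemma OmitBound.le_copy {n N : ℕ} (h : OmitBound n N) (c : Fin 3) {i j k : Fin 3} (hij : i ≠ j)
    (hik : i ≠ k) (hjk : j ≠ k) : (N : ℕ∞) ≤ {l | PathOn (n + 1) (copy n c \ {junction n k c})
      (junction n i c) {junction n j c} l}.encard := by
  have := le_encard_pathOn_shift c (h i j k hij hik hjk)
  rwa [Set.image_singleton, Set.image_sdiff (add_left_injective _), Set.image_singleton] at this

lemma StartBound.le_copy {n N : ℕ} (h : StartBound n N) (c i : Fin 3) :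
    (N : ℕ∞) ≤ {l | PathOn (n + 1) (copy n c) (junction n i c)
      (copy n c \ {junction n i c}) l}.encard := by
  have := le_encard_pathOn_shift c (h i)
  rwa [Set.image_sdiff (add_left_injective _), Set.image_singleton] at this

lemma FullBound.succ {n F G : ℕ} (hF : FullBound n F) (hG : OmitBound n G) :
    FullBound (n + 1) (2 * F ^ 2 * G) := by
  intro i j hij
  obtain ⟨k, hik, hjk⟩ : ∃ k, i ≠ k ∧ j ≠ k := by decide +revert
  have hV := fun v => mem_V_succ_iff_copy (n := n) hij hik hjk (v := v)
  have eij := fun v => eq_junction (n := n) hij (v := v)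
  have eik := fun v => eq_junction (n := n) hik (v := v)
  have ejk := fun v => eq_junction (n := n) hjk (v := v)
  have mij := junction_mem_left n i j
  have mij' := junction_mem_right n i j
  have hJ : junction n i j ≠ junction n i k := (junction_right_injective n i).ne hjk
  have hJ' : junction n i j ≠ junction n j k := fun h =>
    (junction_right_injective n j).ne hik ((junction_comm n j i).trans h)
  have h1 := le_encard_pathOn_join (u := copy n k ∪ copy n j) (by grind) rfl
    (hF.le_copy k hij) ((junction_comm n j k) ▸ hF.le_copy j hjk.symm)
  have h2 := le_encard_pathOn_join (u := copy n k ∪ (copy n j \ {junction n i j})) (by grind) rfl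
    (hF.le_copy k hij) ((junction_comm n j k) ▸ hG.le_copy j hjk.symm hik.symm hij.symm)
  have h3 := le_encard_pathOn_join_add (u := V (n + 1)) (by grind) (by grind) (by grind)
    (by grind) (by grind) ((junction_comm n j i) ▸ (junction_comm n k i) ▸ hG.le_copy i hik hij hjk.symm)
    h1
    ((junction_comm n k i) ▸ hF.le_copy i hik) h2
  rw [junction_self, junction_self] at h3
  refine le_trans (le_of_eq ?_) h3
  push_cast
  ring

lemma OmitBound.succ {n F G : ℕ} (hF : FullBound n F) (hG : OmitBound n G) :
    OmitBound (n + 1) (2 * F * G ^ 2) := by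
  intro i j k hij hik hjk
  have hV := fun v => mem_V_succ_iff_copy (n := n) hij hik hjk (v := v)
  have eij := fun v => eq_junction (n := n) hij (v := v)
  have eik := fun v => eq_junction (n := n) hik (v := v)
  have ejk := fun v => eq_junction (n := n) hjk (v := v)
  have mij := junction_mem_left n i j
  have mij' := junction_mem_right n i j
  have hki := junction_notMem hik.symm hik.symm (n := n)
  have hkj := junction_notMem hjk.symm hjk.symm (n := n)
  have hkk := junction_mem_left n k k
  have hJ : junction n i j ≠ junction n i k := (junction_right_injective n i).ne hjk
  have hJ' : junction n i j ≠ junction n j k := fun h =>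
    (junction_right_injective n j).ne hik ((junction_comm n j i).trans h)
  have h1 := le_encard_pathOn_join (u := (copy n k \ {junction n k k}) ∪ copy n j) (by grind) rfl
    (hG.le_copy k hij hik hjk) ((junction_comm n j k) ▸ hF.le_copy j hjk.symm)
  have h2 := le_encard_pathOn_join
    (u := (copy n k \ {junction n k k}) ∪ (copy n j \ {junction n i j})) (by grind) rfl
    (hG.le_copy k hij hik hjk)
    ((junction_comm n j k) ▸ hG.le_copy j hjk.symm hik.symm hij.symm)
  have h3 := le_encard_pathOn_join_add (u := V (n + 1) \ {junction n k k}) (by grind) (by grind)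
    (by grind) (by grind) (by grind)
    ((junction_comm n j i) ▸ (junction_comm n k i) ▸ hG.le_copy i hik hij hjk.symm)
    h1
    ((junction_comm n k i) ▸ hF.le_copy i hik) h2
  rw [junction_self, junction_self, junction_self] at h3
  refine le_trans (le_of_eq ?_) h3
  push_cast
  ring

lemma StartBound.le_of_ne {n F G S : ℕ} (hF : FullBound n F) (hG : OmitBound n G)
    (hS : StartBound n S) {i j k : Fin 3} (hij : i ≠ j) (hik : i ≠ k) (hjk : j ≠ k) :
    ((G * (F * S) + F * (F * G) : ℕ) : ℕ∞) ≤ {l | PathOn (n + 1) (V (n + 1)) (junction n i i)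
      (copy n k \ {junction n j k}) l}.encard := by
  have hV := fun v => mem_V_succ_iff_copy (n := n) hij hik hjk (v := v)
  have eij := fun v => eq_junction (n := n) hij (v := v)
  have eik := fun v => eq_junction (n := n) hik (v := v)
  have ejk := fun v => eq_junction (n := n) hjk (v := v)
  have mik := junction_mem_left n i k
  have mik' := junction_mem_right n i k
  have hkj := junction_notMem hjk.symm hjk.symm (n := n)
  have hkk := junction_mem_left n k k
  have mjk := junction_mem_left n j k
  have hJ : junction n i j ≠ junction n i k := (junction_right_injective n i).ne hjk
  have hJ' : junction n j k ≠ junction n i k := fun h => hij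
    (junction_right_injective n k ((junction_comm n k j).trans h |>.trans
      (junction_comm n i k))).symm
  have h0 : {l | PathOn (n + 1) (copy n k \ {junction n i k}) (junction n j k)
      {junction n k k} l} ⊆ {l | PathOn (n + 1) (copy n k \ {junction n i k}) (junction n j k)
      (copy n k \ {junction n j k}) l} := fun l hl => hl.mono (by grind)
  have h1 := le_encard_pathOn_join (u := copy n j ∪ copy n k) (by grind) rfl
    ((junction_comm n k j) ▸ hF.le_copy j hik) (hS.le_copy k j)
  have h2 := le_encard_pathOn_join (u := copy n j ∪ (copy n k \ {junction n i k})) (by grind) rfl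
    ((junction_comm n k j) ▸ hF.le_copy j hik)
    ((hG.le_copy k hjk hij.symm hik.symm).trans (Set.encard_le_encard h0))
  have h3 := le_encard_pathOn_join_add (u := V (n + 1)) (by grind) (by grind)
    (by grind) (by grind) (by grind)
    ((junction_comm n k i) ▸ (junction_comm n j i) ▸ hG.le_copy i hij hik hjk) h1
    ((junction_comm n j i) ▸ hF.le_copy i hij) h2
  refine le_trans (le_of_eq ?_) h3
  push_cast
  ring

lemma StartBound.succ {n F G S : ℕ} (hF : FullBound n F) (hG : OmitBound n G)
    (hS : StartBound n S) : StartBound (n + 1) (2 * (G * (F * S) + F * (F * G))) := by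
  intro i
  obtain ⟨j, k, hij, hik, hjk⟩ : ∃ j k, i ≠ j ∧ i ≠ k ∧ j ≠ k := by decide +revert
  have h := le_encard_pathOn_add (Z'' := V (n + 1) \ {junction n i i}) ?_ ?_
    (hS.le_of_ne hF hG hij hik hjk) (hS.le_of_ne hF hG hik hij hjk.symm)
  · rw [junction_self] at h
    refine le_trans (le_of_eq ?_) h
    push_cast
    ring
  · rw [Set.disjoint_left]
    rintro v ⟨hk, hne⟩ ⟨hj, -⟩
    exact hne (eq_junction hjk hj hk)
  · have hk := junction_notMem hik hik (n := n)
    have hj := junction_notMem hij hij (n := n)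
    have hV := fun v => mem_V_succ_iff_copy (n := n) hij hik hjk (v := v)
    grind

lemma fullBound_zero : FullBound 0 1 := by
  intro i j hij
  obtain ⟨k, hik, hjk⟩ : ∃ k, i ≠ k ∧ j ≠ k := by decide +revert
  have hinj : ∀ {c d}, corner 0 c = corner 0 d ↔ c = d := (corner_injective 0).eq_iff
  rw [Nat.cast_one, Set.one_le_encard_iff_nonempty]
  refine ⟨[corner 0 i, corner 0 k, corner 0 j], ?_, ?_, rfl, ⟨_, rfl, rfl⟩, fun v => ?_⟩
  · simp only [List.isChain_cons_cons, List.isChain_singleton, and_true]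
    exact ⟨mem_E_zero.2 ⟨_, _, hik, rfl⟩, mem_E_zero.2 ⟨_, _, hjk.symm, rfl⟩⟩
  · simp [hinj, hij, hik, hjk.symm]
  · rw [mem_V_zero]
    simp only [List.mem_cons, List.not_mem_nil, or_false]
    constructor
    · rintro (rfl | rfl | rfl) <;> exact ⟨_, rfl⟩
    · rintro ⟨c, rfl⟩
      simp only [hinj]
      omega

lemma omitBound_zero : OmitBound 0 1 := by
  intro i j k hij hik hjk
  have hinj : ∀ {c d}, corner 0 c = corner 0 d ↔ c = d := (corner_injective 0).eq_iff
  rw [Nat.cast_one, Set.one_le_encard_iff_nonempty]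
  refine ⟨[corner 0 i, corner 0 j], ?_, ?_, rfl, ⟨_, rfl, rfl⟩, fun v => ?_⟩
  · simp only [List.isChain_cons_cons, List.isChain_singleton, and_true]
    exact mem_E_zero.2 ⟨_, _, hij, rfl⟩
  · simp [hinj, hij]
  · rw [Set.mem_sdiff, mem_V_zero, Set.mem_singleton_iff]
    simp only [List.mem_cons, List.not_mem_nil, or_false]
    constructor
    · rintro (rfl | rfl)
      · exact ⟨⟨_, rfl⟩, fun h => hik (hinj.1 h)⟩
      · exact ⟨⟨_, rfl⟩, fun h => hjk (hinj.1 h)⟩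
    · rintro ⟨⟨c, rfl⟩, hc⟩
      simp only [hinj] at hc ⊢
      omega

lemma junction_adj (c : Fin 3) {d e : Fin 3} (hde : d ≠ e) :
    s(junction 0 c d, junction 0 c e) ∈ E 1 :=
  mem_E_succ.2 ⟨c, _, mem_E_zero.2 ⟨d, e, hde, rfl⟩, by
    rw [Sym2.map_mk, add_comm, add_comm (corner 0 e)]; rfl⟩

lemma junction_eq_iff {n : ℕ} {c d c' d' : Fin 3} : junction n c d = junction n c' d' ↔
    c = c' ∧ d = d' ∨ c = d' ∧ d = c' := by
  constructor
  · intro h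
    by_cases hc : c' = c
    · subst hc
      exact Or.inl ⟨rfl, junction_right_injective n _ h⟩
    · by_cases hd : d' = c
      · subst hd
        exact Or.inr ⟨rfl, junction_right_injective n _ (h.trans (junction_comm n c' _))⟩
      · exact absurd (h ▸ junction_mem_left n c d) (junction_notMem hc hd)
  · rintro (⟨rfl, rfl⟩ | ⟨rfl, rfl⟩)
    exacts [rfl, junction_comm n _ _]

lemma mem_V_one {v : ℝ × ℝ} : v ∈ V 1 ↔ ∃ c d, junction 0 c d = v := by
  rw [mem_V_succ]
  constructor
  · rintro ⟨c, _, hy, rfl⟩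
    obtain ⟨d, rfl⟩ := mem_V_zero.1 hy
    exact ⟨d, c, rfl⟩
  · rintro ⟨d, c, rfl⟩
    exact ⟨c, _, corner_mem_V 0 d, rfl⟩

lemma omitBound_one : OmitBound 1 3 := by
  intro i j k hij hik hjk
  have hmem : ∀ v, v ∈ V 1 \ {corner 1 k} ↔ v = junction 0 i i ∨ v = junction 0 j j ∨
      v = junction 0 i j ∨ v = junction 0 i k ∨ v = junction 0 j k := by
    intro v
    rw [Set.mem_sdiff, mem_V_one, Set.mem_singleton_iff, ← junction_self]
    constructor
    · rintro ⟨⟨c, d, rfl⟩, h⟩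
      have hc : c = i ∨ c = j ∨ c = k := by omega
      have hd : d = i ∨ d = j ∨ d = k := by omega
      rcases hc with rfl | rfl | rfl <;> rcases hd with rfl | rfl | rfl <;>
        simp_all [junction_eq_iff]
    · rintro (rfl | rfl | rfl | rfl | rfl) <;> refine ⟨⟨_, _, rfl⟩, ?_⟩ <;>
        simp [junction_eq_iff, hik, hjk]
  have hji := hij.symm
  have hki := hik.symm
  have hkj := hjk.symm
  have aij : s(junction 0 i i, junction 0 i j) ∈ E 1 := junction_adj i hij
  have aik : s(junction 0 i i, junction 0 i k) ∈ E 1 := junction_adj i hik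
  have ajj : s(junction 0 i j, junction 0 j j) ∈ E 1 := junction_comm 0 j i ▸ junction_adj j hij
  have akk : s(junction 0 j k, junction 0 j j) ∈ E 1 := junction_adj j hkj
  have bi : s(junction 0 i j, junction 0 i k) ∈ E 1 := junction_adj i hjk
  have bj : s(junction 0 i j, junction 0 j k) ∈ E 1 := junction_comm 0 j i ▸ junction_adj j hik
  have bk : s(junction 0 i k, junction 0 j k) ∈ E 1 :=
    junction_comm 0 k i ▸ junction_comm 0 k j ▸ junction_adj k hij
  have key : ∀ {p q r : ℝ × ℝ}, s(junction 0 i i, p) ∈ E 1 → s(p, q) ∈ E 1 → s(q, r) ∈ E 1 →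
      s(r, junction 0 j j) ∈ E 1 → [junction 0 i j, junction 0 i k, junction 0 j k].Perm [p, q, r] →
      PathOn 1 (V 1 \ {corner 1 k}) (junction 0 i i) {junction 0 j j}
        [junction 0 i i, p, q, r, junction 0 j j] := by
    intro p q r h1 h2 h3 h4 hp
    have hperm : [junction 0 i i, junction 0 i j, junction 0 i k, junction 0 j k,
        junction 0 j j].Perm [junction 0 i i, p, q, r, junction 0 j j] :=
      (hp.append_right [junction 0 j j]).cons _
    refine ⟨by simp [h1, h2, h3, h4], hperm.nodup_iff.1 ?_, rfl, ⟨_, rfl, rfl⟩, fun v => ?_⟩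
    · simp [junction_eq_iff, *]
    · rw [← hperm.mem_iff, hmem]
      simp only [List.mem_cons, List.not_mem_nil, or_false]
      tauto
  have hne1 : junction 0 i k ≠ junction 0 i j := (junction_right_injective 0 i).ne hkj
  have hne2 : junction 0 i j ≠ junction 0 j k := by simp [junction_eq_iff, *]
  rw [← junction_self 0 i, ← junction_self 0 j]
  have hcard := Set.encard_eq_three.2 ⟨
    [junction 0 i i, junction 0 i k, junction 0 i j, junction 0 j k, junction 0 j j],
    [junction 0 i i, junction 0 i j, junction 0 i k, junction 0 j k, junction 0 j j],
    [junction 0 i i, junction 0 i k, junction 0 j k, junction 0 i j, junction 0 j j],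
    by simp [hne1], by simp [hne2], by simp [hne1.symm], rfl⟩
  refine hcard.symm.le.trans (Set.encard_le_encard ?_)
  rintro _ (rfl | rfl | rfl)
  · exact key aik (Sym2.eq_swap ▸ bi) bj akk (List.Perm.swap _ _ _)
  · exact key aij bi bk akk (List.Perm.refl _)
  · exact key aik bk (Sym2.eq_swap ▸ bj) ajj
      ((List.Perm.swap _ _ _).trans ((List.Perm.swap _ _ _).cons _))

lemma fullBound_and_omitBound (n : ℕ) :
    FullBound n (pathCount n).1 ∧ OmitBound n (pathCount n).2 := by
  induction n with
  | zero => exact ⟨fullBound_zero, omitBound_zero⟩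
  | succ n ih =>
    refine ⟨FullBound.succ ih.1 ih.2, ?_⟩
    rcases eq_or_ne n 0 with rfl | hn
    · exact omitBound_one
    · rw [pathCount_succ_snd, if_neg hn]
      exact OmitBound.succ ih.1 ih.2

lemma startBound (n : ℕ) : StartBound n (n * (pathCount n).1) := by
  induction n with
  | zero =>
    intro i
    simp
  | succ n ih =>
    have h := fullBound_and_omitBound n
    convert StartBound.succ h.1 h.2 ih using 1
    rw [pathCount_succ_fst]
    ring

lemma le_card_hamLists (n : ℕ) : n * (pathCount n).1 ≤ (hamLists n).card := by
  rw [← ENat.natCast_le_natCast, ← Set.encard_coe_eq_coe_finsetCard]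
  exact (startBound n 0).trans (Set.encard_le_encard fun l hl =>
    mem_hamLists.2 ⟨hl.isChain, hl.nodup, hl.mem_iff⟩)

lemma pathCount_fst_eq_exp (m : ℕ) :
    ((pathCount (m + 1)).1 : ℝ) = Real.exp ((3 ^ m * Real.log 12 - Real.log 3) / 2) := by
  have h : (3 : ℝ) * ((pathCount (m + 1)).1 : ℝ) ^ 2 = 12 ^ 3 ^ m := by
    exact_mod_cast three_mul_pathCount_sq m
  refine (pow_left_inj₀ (Nat.cast_nonneg _) (Real.exp_pos _).le two_ne_zero).1 ?_
  rw [← Real.exp_nat_mul, Nat.cast_two, mul_div_cancel₀ _ two_ne_zero, Real.exp_sub,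
    Real.exp_log three_pos, eq_div_iff three_ne_zero, mul_comm, h, mul_comm (3 ^ m : ℝ),
    Real.exp_mul, Real.exp_log (by norm_num)]
  exact_mod_cast (Real.rpow_natCast 12 (3 ^ m)).symm

lemma pathCount_mul_exp (m : ℕ) (β : ℝ) : ((pathCount (m + 1)).1 : ℝ) *
    Real.exp (-(β * ((3 ^ (m + 1 + 1) + 1) / 2))) =
      Real.exp (-((9 * β - Real.log 12) / 2 * 3 ^ m)) * Real.exp (-((Real.log 3 + β) / 2)) := by
  rw [pathCount_fst_eq_exp, ← Real.exp_add, ← Real.exp_add]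
  congr 1
  ring

lemma Z_succ_le (m : ℕ) {β : ℝ} (hβ : 0 < β) :
    Z (m + 1) β ≤ 663552 * ((3 ^ m) ^ 10 * Real.exp (-((9 * β - Real.log 12) / 2 * 3 ^ m))) := by
  have h1 : (H (m + 1) : ℝ) ≤ 3 ^ (m + 1 + 1) * (8 * 9216 ^ (m + 1) * (pathCount (m + 1)).1) := by
    rw [H_eq]
    exact_mod_cast (Nat.div_le_self _ _).trans (card_hamLists_le (m + 1))
  have h2 : Real.exp (-((Real.log 3 + β) / 2)) ≤ 1 := by
    have := Real.log_pos (x := 3) (by norm_num)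
    exact Real.exp_le_one_iff.2 (by linarith)
  calc Z (m + 1) β ≤ 3 ^ (m + 1 + 1) * (8 * 9216 ^ (m + 1) * (pathCount (m + 1)).1) *
        Real.exp (-(β * ((3 ^ (m + 1 + 1) + 1) / 2))) := by
        rw [Z]
        gcongr
    _ = 3 ^ (m + 1 + 1) * (8 * 9216 ^ (m + 1)) * (Real.exp (-((9 * β - Real.log 12) / 2 * 3 ^ m)) *
        Real.exp (-((Real.log 3 + β) / 2))) := by
        rw [← pathCount_mul_exp]
        ring
    _ ≤ 3 ^ (m + 1 + 1) * (8 * 9216 ^ (m + 1)) *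
        (Real.exp (-((9 * β - Real.log 12) / 2 * 3 ^ m)) * 1) := by gcongr
    _ = 663552 * ((3 * 9216) ^ m * Real.exp (-((9 * β - Real.log 12) / 2 * 3 ^ m))) := by
        rw [mul_pow]
        ring
    _ ≤ 663552 * ((3 ^ m) ^ 10 * Real.exp (-((9 * β - Real.log 12) / 2 * 3 ^ m))) := by
        rw [← pow_mul, mul_comm m, pow_mul]
        gcongr
        norm_num

lemma le_Z_succ (m : ℕ) {β : ℝ} (hβ : β ≤ Real.log 12 / 9) :
    m * (Real.exp (-((Real.log 3 + β) / 2)) / 2) ≤ Z (m + 1) β := by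
  have h1 : (m : ℝ) * (pathCount (m + 1)).1 ≤ 2 * H (m + 1) := by
    have h := le_card_hamLists (m + 1)
    have h' := pathCount_fst_pos (m + 1)
    have h2 : m * (pathCount (m + 1)).1 ≤ 2 * H (m + 1) := by
      rw [H_eq]
      rw [add_one_mul] at h
      omega
    exact_mod_cast h2
  have h2 : 1 ≤ Real.exp (-((9 * β - Real.log 12) / 2 * 3 ^ m)) := by
    refine Real.one_le_exp (neg_nonneg.2 (mul_nonpos_of_nonpos_of_nonneg ?_ (by positivity)))
    linarith
  calc m * (Real.exp (-((Real.log 3 + β) / 2)) / 2)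
      ≤ m * ((Real.exp (-((9 * β - Real.log 12) / 2 * 3 ^ m)) *
          Real.exp (-((Real.log 3 + β) / 2))) / 2) := by
        gcongr
        exact le_mul_of_one_le_left (Real.exp_pos _).le h2
    _ = m * (pathCount (m + 1)).1 / 2 * Real.exp (-(β * ((3 ^ (m + 1 + 1) + 1) / 2))) := by
        rw [← pathCount_mul_exp]
        ring
    _ ≤ Z (m + 1) β := by
        rw [Z]
        gcongr
        linarith

lemma tendsto_pow_mul_exp_neg {δ : ℝ} (hδ : 0 < δ) :
    Tendsto (fun m : ℕ => ((3 : ℝ) ^ m) ^ 10 * Real.exp (-(δ * 3 ^ m))) atTop (𝓝 0) := by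
  have h := ((Real.tendsto_pow_mul_exp_neg_atTop_nhds_zero 10).comp
    ((tendsto_pow_atTop_atTop_of_one_lt (by norm_num : (1 : ℝ) < 3)).const_mul_atTop
      hδ)).const_mul (δ ^ 10)⁻¹
  rw [mul_zero] at h
  refine h.congr fun m => ?_
  simp only [Function.comp_apply, mul_pow δ]
  rw [mul_assoc, inv_mul_cancel_left₀ (by positivity)]

/-- critical inverse temperature of the partition function of
Hamiltonian paths on the Sierpinski gasket. -/
theorem partition_function_critical_beta (β : ℝ) (hβ : 0 < β) :
    (Real.log 12 / 9 < β →
      Filter.Tendsto (fun n : ℕ => Z n β) Filter.atTop (nhds 0)) ∧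
    (β ≤ Real.log 12 / 9 →
      Filter.Tendsto (fun n : ℕ => Z n β) Filter.atTop Filter.atTop) := by
  refine ⟨fun h => ?_, fun h => ?_⟩
  · rw [← tendsto_add_atTop_iff_nat 1]
    have h' := (tendsto_pow_mul_exp_neg (δ := (9 * β - Real.log 12) / 2) (by linarith)).const_mul
      663552
    rw [mul_zero] at h'
    exact squeeze_zero (fun m => by rw [Z]; positivity) (fun m => Z_succ_le m hβ) h'
  · rw [← tendsto_add_atTop_iff_nat 1]
    exact tendsto_atTop_mono (fun m => le_Z_succ m h)
      (tendsto_natCast_atTop_atTop.atTop_mul_const (by positivity))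

end SierpinskiGasket
end
end

section
/- Let f_1, g_1 : ℕ → ℤ satisfy f_1(1) = 2, g_1(1) = 3 and, for all n ≥ 1, f_1(n+1) = 2·f_1(n)²·g_1(n) and g_1(n+1) = 2·g_1(n)²·f_1(n). Then for all n ≥ 1: (i) 2·g_1(n) = 3·f_1(n); (ii) f_1(n+1) = 3·f_1(n)³; and (iii) f_1(n) = 2^(3^(n-1)) · 3^((3^(n-1)−1)/2). -/
/-- the sequences `f₁`, `g₁` satisfying the Sierpinski-gasket
recursion satisfy `2·g₁(n) = 3·f₁(n)`, `f₁(n+1) = 3·f₁(n)³`, and the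
closed form `f₁(n) = 2^(3^(n-1)) · 3^((3^(n-1)-1)/2)`. -/
theorem f1_g1_closed_form (f₁ g₁ : ℕ → ℤ)
    (hf1 : f₁ 1 = 2) (hg1 : g₁ 1 = 3)
    (hfrec : ∀ n : ℕ, 1 ≤ n → f₁ (n + 1) = 2 * f₁ n ^ 2 * g₁ n)
    (hgrec : ∀ n : ℕ, 1 ≤ n → g₁ (n + 1) = 2 * g₁ n ^ 2 * f₁ n) :
    ∀ n : ℕ, 1 ≤ n →
      2 * g₁ n = 3 * f₁ n ∧
      f₁ (n + 1) = 3 * f₁ n ^ 3 ∧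
      f₁ n = 2 ^ 3 ^ (n - 1) * 3 ^ ((3 ^ (n - 1) - 1) / 2) := by
  have ratio : ∀ n : ℕ, 1 ≤ n → 2 * g₁ n = 3 * f₁ n := by
    intro n hn
    induction n, hn using Nat.le_induction with
    | base => rw [hf1, hg1]; norm_num
    | succ n hn ih =>
      rw [hfrec n hn, hgrec n hn]
      linear_combination 2 * g₁ n * f₁ n * ih
  have cube : ∀ n : ℕ, 1 ≤ n → f₁ (n + 1) = 3 * f₁ n ^ 3 := by
    intro n hn
    rw [hfrec n hn]
    linear_combination f₁ n ^ 2 * ratio n hn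
  refine fun n hn => ⟨ratio n hn, cube n hn, ?_⟩
  obtain ⟨k, rfl⟩ := Nat.exists_eq_add_of_le' hn
  clear hn
  rw [Nat.add_sub_cancel]
  induction k with
  | zero => simp [hf1]
  | succ k ih =>
    obtain ⟨e, he⟩ : Odd (3 ^ k) := Odd.pow (by decide)
    have h₁ : (3 ^ k - 1) / 2 = e := by omega
    have h₂ : (3 ^ (k + 1) - 1) / 2 = 3 * e + 1 := by omega
    rw [cube (k + 1) (by omega), ih, h₁, h₂, pow_succ 3 k]
    ring
end

section
/- Let α_2, β_2, β_3, γ_1 : ℕ → ℚ satisfy the initial conditions α_2(1) = 1, β_2(1) = 3/2, β_3(1) = 2, γ_1(1) = 2 and, for all n ≥ 1, the recursion α_2(n+1) = 1 + α_2(n) + (2/3)β_2(n) + (2/3)β_3(n); β_2(n+1) = 3/2 + (3/4)α_2(n) + β_2(n) + β_3(n) + (1/3)γ_1(n); β_3(n+1) = 3 + (3/4)α_2(n) + β_2(n) + 3β_3(n) + (1/3)γ_1(n); γ_1(n+1) = 9/4 + (3/2)β_2(n) + (3/2)β_3(n) + γ_1(n). Then for all n ≥ 1: α_2(n) = (7·17/(2^4·3^3))·4^n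 − 2/3^3 − (1/(2^2·3^2))·δ_{n,1}; β_2(n) = (7·17/(2^5·3^2))·4^n − 7/(2^2·3^2) + (1/(2^3·3))·δ_{n,1}; β_3(n) = (7·17/(2^4·3^2))·4^n − 47/(2^2·3^2); γ_1(n) = (7·17/(2^6·3))·4^n − 5/(2^2·3) − (1/2^4)·δ_{n,1}, where δ_{n,1} is the Kronecker delta. -/
/-- closed forms for the ratio sequences `α₂, β₂, β₃, γ₁`. -/
theorem ratio_sequences_closed_form (α₂ β₂ β₃ γ₁ : ℕ → ℚ)
    (hα : α₂ 1 = 1) (hβ₂ : β₂ 1 = 3 / 2) (hβ₃ : β₃ 1 = 2) (hγ : γ₁ 1 = 2)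
    (rα : ∀ n : ℕ, 1 ≤ n →
      α₂ (n + 1) = 1 + α₂ n + (2 / 3) * β₂ n + (2 / 3) * β₃ n)
    (rβ₂ : ∀ n : ℕ, 1 ≤ n →
      β₂ (n + 1) = 3 / 2 + (3 / 4) * α₂ n + β₂ n + β₃ n + (1 / 3) * γ₁ n)
    (rβ₃ : ∀ n : ℕ, 1 ≤ n →
      β₃ (n + 1) = 3 + (3 / 4) * α₂ n + β₂ n + 3 * β₃ n + (1 / 3) * γ₁ n)
    (rγ : ∀ n : ℕ, 1 ≤ n →
      γ₁ (n + 1) = 9 / 4 + (3 / 2) * β₂ n + (3 / 2) * β₃ n + γ₁ n) :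
    ∀ n : ℕ, 1 ≤ n →
      α₂ n = (7 * 17 / (2 ^ 4 * 3 ^ 3)) * 4 ^ n - 2 / 3 ^ 3 -
        (if n = 1 then 1 / (2 ^ 2 * 3 ^ 2) else 0) ∧
      β₂ n = (7 * 17 / (2 ^ 5 * 3 ^ 2)) * 4 ^ n - 7 / (2 ^ 2 * 3 ^ 2) +
        (if n = 1 then 1 / (2 ^ 3 * 3) else 0) ∧
      β₃ n = (7 * 17 / (2 ^ 4 * 3 ^ 2)) * 4 ^ n - 47 / (2 ^ 2 * 3 ^ 2) ∧
      γ₁ n = (7 * 17 / (2 ^ 6 * 3)) * 4 ^ n - 5 / (2 ^ 2 * 3) -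
        (if n = 1 then 1 / 2 ^ 4 else 0) := by
  intro n hn
  induction n, hn using Nat.le_induction with
  | base => norm_num [hα, hβ₂, hβ₃, hγ]
  | succ n hn ih =>
    obtain ⟨iα, iβ₂, iβ₃, iγ⟩ := ih
    have hne : n + 1 ≠ 1 := by lia
    rw [rα n hn, rβ₂ n hn, rβ₃ n hn, rγ n hn, iα, iβ₂, iβ₃, iγ]
    simp only [if_neg hne, pow_succ (4 : ℚ) n]
    split_ifs <;> refine ⟨?_, ?_, ?_, ?_⟩ <;> ring
end
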